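/- arXiv:1503.07156 — 2 statements merged into one kernel-verified Lean document; each statement's English description precedes it below -/
import Mathlib

section
/- Let $p$ be a prime and $\chi$ a primitive (i.e., nontrivial) Dirichlet character modulo $p$. For integers $h, x$, the sum $W_{\chi,h}(x) = \sum_{n \bmod p} \chi(n) \overline{\chi(n+h)} e^{2\pi i n x/p}$ satisfies $|W_{\chi,h}(x)| \ll p^{1/2} \gcd(h, x, p)^{1/2}$, with an absolute implied constant. In particular, if $p \nmid h$ or $p \nmid x$, then $|W_{\chi,h}(x)| \ll \sqrt{p}$. -/
open Finset Complex

/-- The complete sum `W_{χ,h}(x) = ∑_{n mod q} χ(n) \overline{χ(n+h)} e(nx/q)`. -/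
noncomputable def Wsum {q : ℕ} (χ : DirichletCharacter ℂ q) (h x : ℤ) : ℂ :=
  ∑ n ∈ Finset.range q,
    χ (n : ZMod q) * (starRingEnd ℂ) (χ ((n : ZMod q) + (h : ZMod q))) *
      Complex.exp (2 * Real.pi * Complex.I * n * x / q)

namespace WB
open Polynomial

lemma exists_rel {L ι : Type*} [Field L] [Fintype ι] (E : ℕ) (P : ι → L[X])
    (hP : ∀ i, (P i).degree < E) (h : E < Fintype.card ι) :
    ∃ c : ι → L, (∑ i, C (c i) * P i = 0) ∧ ∃ i, c i ≠ 0 := by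
  have hfin : Module.finrank L (degreeLT L E) = E := by
    rw [LinearEquiv.finrank_eq (degreeLTEquiv L E)]; simp
  have : ¬ LinearIndependent L (fun i => (⟨P i, mem_degreeLT.2 (hP i)⟩ : degreeLT L E)) := by
    intro hl
    have : Module.Finite L (degreeLT L E) := Module.Finite.equiv (degreeLTEquiv L E).symm
    have := hl.fintype_card_le_finrank
    omega
  rw [Fintype.not_linearIndependent_iff] at this
  obtain ⟨c, hc, hi⟩ := this
  refine ⟨c, ?_, hi⟩
  have := congrArg Subtype.val hc
  simpa [Polynomial.smul_eq_C_mul] using this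

lemma stepanov_abs {L ι : Type*} [Field L] [IsAlgClosed L] [Fintype ι] (p : ℕ) [Fact p.Prime] [CharP L p]
    (μ E D : ℕ) (P R : ι → L[X]) (hP : ∀ i, (P i).degree < E) (hE : E < Fintype.card ι)
    (hR : ∀ i, (R i).natDegree ≤ D)
    (ord : ι → ℕ) (hord : Function.Injective ord)
    (hR1 : ∀ i, X ^ (ord i) ∣ R i) (hR2 : ∀ i, (R i).coeff (ord i) ≠ 0)
    (S : Finset L) (hS : ∀ w ∈ S, ∃ x y : L, x ≠ 0 ∧
      ∀ i, (R i).eval w ^ (p ^ μ) * x = (P i).eval w * y) :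
    S.card ≤ D := by
  classical
  obtain ⟨c', hc', i0, hi0⟩ := exists_rel E P hP hE
  have hp : 0 < p ^ μ := pow_pos (Fact.out : p.Prime).pos _
  choose c hc using fun i => IsAlgClosed.exists_pow_nat_eq (c' i) hp
  set Ψ : L[X] := ∑ i, C (c i) * R i with hΨ
  have hne : Ψ ≠ 0 := by
    let T : Finset ι := univ.filter (fun i => c i ≠ 0)
    have hT : T.Nonempty := ⟨i0, by
      simp only [T, mem_filter, mem_univ, true_and]
      intro h; apply hi0; rw [← hc, h, zero_pow hp.ne']⟩
    obtain ⟨j, hj, hmin⟩ := T.exists_min_image ord hT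
    intro h0
    have h1 : Ψ.coeff (ord j) = c j * (R j).coeff (ord j) := by
      rw [hΨ, finsetSum_coeff, Finset.sum_eq_single j]
      · simp
      · intro i _ hij
        rw [coeff_C_mul]
        by_cases hci : c i = 0
        · simp [hci]
        · have hle : ord j ≤ ord i := hmin i (by simp [T, hci])
          have hlt : ord j < ord i := lt_of_le_of_ne hle (fun h => hij (hord h).symm)
          rw [X_pow_dvd_iff.1 (hR1 i) _ hlt, mul_zero]
      · simp
    rw [h0, coeff_zero] at h1
    have : c j ≠ 0 := by simpa [T] using hj
    exact mul_ne_zero this (hR2 j) h1.symm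
  have hdeg : Ψ.natDegree ≤ D := by
    apply natDegree_sum_le_of_forall_le
    intro i _
    exact (natDegree_C_mul_le _ _).trans (hR i)
  refine le_trans ?_ hdeg
  apply card_le_degree_of_subset_roots
  intro w hw
  rw [mem_roots hne, IsRoot]
  obtain ⟨x, y, hx, hxy⟩ := hS w hw
  have : (Ψ.eval w) ^ (p ^ μ) * x = 0 := by
    rw [hΨ, eval_finsetSum, sum_pow_char_pow, Finset.sum_mul]
    calc _ = ∑ i, (c' i * (P i).eval w) * y := by
            apply Finset.sum_congr rfl
            intro i _
            rw [eval_mul, eval_C, mul_pow, hc, mul_assoc, hxy, mul_assoc]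
      _ = (∑ i, C (c' i) * P i).eval w * y := by
            rw [← Finset.sum_mul, eval_finsetSum]; simp
      _ = 0 := by rw [hc']; simp
  have h2 := (mul_eq_zero.1 this).resolve_right hx
  exact pow_eq_zero_iff hp.ne' |>.1 h2

lemma stepanov {L : Type*} [Field L] [IsAlgClosed L] (p : ℕ) [Fact p.Prime] [CharP L p] (hp3 : 3 ≤ p)
    (μ Q t : ℕ) (hμ : 1 ≤ μ) (hQ : Q = p ^ μ) (ht : (p - 1) * t + 1 = Q) (κ a : L)
    (S : Finset L) (hS : ∀ w ∈ S, w ^ (Q * Q) = w + κ ∧ w ^ p - w ≠ 0 ∧ w ^ p - w + 1 ≠ 0 ∧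
      (w ^ p - w) ^ (t * (Q + 1)) = a * (w ^ p - w + 1) ^ (t * (Q + 1))) :
    S.card ≤ (t + 2 * p + 10) * Q := by
  obtain ⟨d, rfl⟩ : ∃ d, p = d + 2 := ⟨p - 2, by omega⟩
  have ht' : (d + 1) * t + 1 = Q := ht
  have hQp : d + 2 ≤ Q := by
    rw [hQ]; exact Nat.le_self_pow (by omega) _
  have ht1 : 1 ≤ t := by
    rcases Nat.eq_zero_or_pos t with h | h
    · subst h; omega
    · exact h
  set p := d + 2 with hpd
  let f : L[X] := X ^ p - X
  let g : L[X] := X ^ p - X + 1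
  have hf : f.natDegree ≤ p := by
    simp only [f]; compute_degree; omega
  have hg : g.natDegree ≤ p := by
    simp only [g]; compute_degree; omega
  let B := t + p + 8
  let ι := Fin B × Fin (d + 1) × Fin t
  let P : ι → L[X] := fun i => C (a ^ (i.2.1 : ℕ)) * (f ^ ((d - i.2.1) * t) * g ^ (i.2.1 * t)) *
    (X ^ (i.2.2 * Q : ℕ) * (X + C κ) ^ (i.1 : ℕ))
  let R : ι → L[X] := fun i => f ^ (i.2.1 * t) * g ^ ((d - i.2.1) * t) *
    X ^ (i.2.2 + i.1 * Q : ℕ)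
  have key : d * t + t + 1 = Q := by rw [← ht']; ring
  refine stepanov_abs (ι := ι) p μ (d * t * p + (t - 1) * Q + B) _ P R ?_ ?_ ?_
    (fun i => i.2.1 * t + i.2.2 + i.1 * Q) ?_ ?_ ?_ S ?_
  · rintro ⟨i, j, l⟩
    apply lt_of_le_of_lt degree_le_natDegree
    have hj : (j : ℕ) ≤ d := by omega
    have h1 : (P (i, j, l)).natDegree ≤ ((d - j) * t * p + j * t * p) + (l * Q + i * 1) := by
      simp only [P]
      refine natDegree_mul_le_of_le ?_ ?_
      · refine (natDegree_C_mul_le _ _).trans ?_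
        exact natDegree_mul_le_of_le (natDegree_pow_le_of_le _ hf) (natDegree_pow_le_of_le _ hg)
      · refine natDegree_mul_le_of_le (natDegree_X_pow_le _) (natDegree_pow_le_of_le _ ?_)
        simp
    have h2 : (d - j) * t * p + j * t * p = d * t * p := by
      rw [← add_mul, ← add_mul, Nat.sub_add_cancel hj]
    have h3 : (l : ℕ) * Q ≤ (t - 1) * Q := Nat.mul_le_mul_right _ (by omega)
    have h4 := i.2
    exact_mod_cast lt_of_le_of_lt h1 (by omega)
  · simp only [ι, Fintype.card_prod, Fintype.card_fin]
    have hd : 1 ≤ d := by omega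
    have h1 : d * t * p ≤ Q * p := Nat.mul_le_mul_right _ (by omega)
    have h2 : 2 * t + 1 ≤ Q := by nlinarith
    obtain ⟨r, rfl⟩ : ∃ r, t = r + 1 := ⟨t - 1, by omega⟩
    have h3 : r + 1 - 1 = r := by omega
    rw [h3]
    have h4 : (d + 1) * (r + 1) = Q - 1 := by omega
    rw [h4]
    obtain ⟨e, he⟩ : ∃ e, Q = e + 1 := ⟨Q - 1, by omega⟩
    have h5 : Q - 1 = e := by omega
    rw [h5]
    simp only [B]
    have h6 : (r + 1 + p + 8) * e = r * e + e * p + 9 * e := by ring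
    have h7 : r * Q = r * e + r := by rw [he]; ring
    have h8 : Q * p = e * p + p := by rw [he]; ring
    omega
  · rintro ⟨i, j, l⟩
    have hj : (j : ℕ) ≤ d := by omega
    have h1 : (R (i, j, l)).natDegree ≤ (j * t * p + (d - j) * t * p) + (l + i * Q) := by
      simp only [R]
      refine natDegree_mul_le_of_le ?_ (natDegree_X_pow_le _)
      exact natDegree_mul_le_of_le (natDegree_pow_le_of_le _ hf) (natDegree_pow_le_of_le _ hg)
    have h2 : j * t * p + (d - j) * t * p = d * t * p := by
      rw [← add_mul, ← add_mul, Nat.add_sub_cancel' hj]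
    have h3 : (i : ℕ) * Q ≤ (t + p + 7) * Q := Nat.mul_le_mul_right _ (by have := i.2; omega)
    have h4 : d * t * p ≤ Q * p := Nat.mul_le_mul_right _ (by omega)
    have h5 := l.2
    have h6 : (t + 2 * p + 10) * Q = (t + p + 7) * Q + Q * p + 3 * Q := by ring
    omega
  · rintro ⟨i, j, l⟩ ⟨i', j', l'⟩ h
    have h : (j : ℕ) * t + l + i * Q = j' * t + l' + i' * Q := h
    have hb : ∀ (j : Fin (d + 1)) (l : Fin t), j * t + l < Q := by
      intro j l
      have : (j : ℕ) * t ≤ d * t := Nat.mul_le_mul_right _ (by omega)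
      omega
    have hQ0 : 0 < Q := by omega
    have e1 : (i : ℕ) = i' := by
      have := congrArg (· / Q) h
      simp only [Nat.add_mul_div_right _ _ hQ0, Nat.div_eq_of_lt (hb _ _)] at this
      omega
    have h' : (j : ℕ) * t + l = j' * t + l' := by rw [e1] at h; omega
    have e2 : (j : ℕ) = j' := by
      have := congrArg (· / t) h'
      simp only [add_comm _ (l : ℕ), add_comm _ (l' : ℕ), Nat.add_mul_div_right _ _ ht1,
        Nat.div_eq_of_lt l.2, Nat.div_eq_of_lt l'.2] at this
      omega
    have e3 : (l : ℕ) = l' := by rw [e2] at h'; omega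
    exact Prod.ext (Fin.ext e1) (Prod.ext (Fin.ext e2) (Fin.ext e3))
  all_goals
    have hfX : f = X * (X ^ (d + 1) - 1) := by simp only [f, hpd]; ring
    have hRe : ∀ i, R i = X ^ (i.2.1 * t + i.2.2 + i.1 * Q : ℕ) *
        ((X ^ (d + 1) - 1) ^ (i.2.1 * t : ℕ) * g ^ ((d - i.2.1) * t)) := by
      intro i
      simp only [R]
      rw [hfX, mul_pow]
      ring
  · intro i
    rw [hRe]
    exact Dvd.intro _ rfl
  · intro i
    rw [hRe, coeff_X_pow_mul', if_pos le_rfl, Nat.sub_self, coeff_zero_eq_eval_zero]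
    simp [g, hpd]
  · intro w hw
    obtain ⟨h1, h2, h3, h4⟩ := hS w hw
    set F := w ^ p - w with hF
    set G := F + 1 with hG
    have efw : f.eval w = F := by simp [f, hF]
    have egw : g.eval w = G := by simp [g, hF, hG]
    refine ⟨(F * G) ^ (d * t), G ^ (t * (Q + 1) * d), pow_ne_zero _ (mul_ne_zero h2 h3), ?_⟩
    rintro ⟨i, j, l⟩
    simp only [P, R, eval_mul, eval_pow, efw, egw, eval_C, eval_X, eval_add, ← hQ]
    obtain ⟨e, he⟩ : ∃ e, d = j + e := ⟨d - j, by omega⟩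
    have he' : d - j = e := by omega
    rw [he', ← h1]
    clear_value F G
    generalize (j : ℕ) = jj at *
    generalize (l : ℕ) = ll at *
    generalize (i : ℕ) = ii at *
    have h5 : F ^ (t * (Q + 1) * jj) = a ^ jj * G ^ (t * (Q + 1) * jj) := by
      rw [pow_mul, h4, mul_pow, ← pow_mul]
    calc _ = F ^ (t * (Q + 1) * jj) * (F ^ (e * t) * G ^ (e * t * Q + d * t) * w ^ ((ll + ii * Q) * Q)) := by
          rw [he]; ring
      _ = _ := by rw [h5, he]; ring
end WB


namespace WB
open Polynomial

noncomputable def WK (p : ℕ) [Fact p.Prime] (χ : DirichletCharacter ℂ p) (ψ : AddChar (ZMod p) ℂ)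
    (K : Type) [Field K] [Fintype K] [Algebra (ZMod p) K] : ℂ :=
  ∑ n : K, χ (Algebra.norm (ZMod p) n) * (starRingEnd ℂ) (χ (Algebra.norm (ZMod p) (n + 1))) *
    ψ (Algebra.trace (ZMod p) K n)

lemma class_bound (p : ℕ) [Fact p.Prime] (hp3 : 3 ≤ p)
    (K : Type) [Field K] [Fintype K] [Algebra (ZMod p) K]
    (μ Q t : ℕ) (hμ : 1 ≤ μ) (hQ : Q = p ^ μ) (ht : (p - 1) * t + 1 = Q)
    (hK : Fintype.card K = Q * Q) (a b : ZMod p) (S : Finset K)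
    (hS : ∀ n ∈ S, n ≠ 0 ∧ n + 1 ≠ 0 ∧
      Algebra.norm (ZMod p) n = a * Algebra.norm (ZMod p) (n + 1) ∧
      Algebra.trace (ZMod p) K n = b) :
    p * S.card ≤ (t + 2 * p + 10) * Q := by
  classical
  have hpp : p.Prime := Fact.out
  let L := AlgebraicClosure K
  let e := algebraMap K L
  have : CharP K p := charP_of_injective_algebraMap (algebraMap (ZMod p) K).injective p
  have : CharP L p := charP_of_injective_algebraMap (algebraMap K L).injective p
  let g : K → L[X] := fun n => X ^ p - X - C (e n)
  have hgd : ∀ n, (g n).natDegree = p := by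
    intro n
    simp only [g]
    compute_degree
    · rw [if_neg (by omega : ¬ p = 0), if_neg (by omega : ¬ 1 = p)]; simp
    · omega
  have hg0 : ∀ n, g n ≠ 0 := fun n h => by
    have := hgd n
    rw [h] at this; simp at this; omega
  have hgs : ∀ n, (g n).Separable := by
    intro n
    have : derivative (g n) = -1 := by
      have h0 : derivative (X ^ p : L[X]) = 0 := by rw [derivative_X_pow]; simp
      simp only [g, derivative_sub, h0, derivative_X, derivative_C]; ring
    rw [Polynomial.separable_def, this]
    exact isCoprime_one_right.neg_right
  let T : K → Finset L := fun n => (g n).roots.toFinset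
  have hT : ∀ n, (T n).card = p := by
    intro n
    simp only [T]
    rw [Multiset.toFinset_card_of_nodup (nodup_roots (hgs n)),
      splits_iff_card_roots.1 (IsAlgClosed.splits (g n)), hgd]
  have memT : ∀ n w, w ∈ T n → w ^ p = w + e n := by
    intro n w hw
    simp only [T, Multiset.mem_toFinset, mem_roots (hg0 n), IsRoot, g, eval_sub, eval_pow, eval_X, eval_C] at hw
    linear_combination hw
  have hcard : (S.biUnion T).card = p * S.card := by
    rw [Finset.card_biUnion, Finset.sum_congr rfl (fun n _ => hT n)]
    · simp [mul_comm]
    · intro n _ m _ hnm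
      change Disjoint (T n) (T m)
      rw [Finset.disjoint_left]
      intro w hw hw'
      apply hnm
      apply e.injective
      have h1 := memT _ _ hw
      have h2 := memT _ _ hw'
      linear_combination h2 - h1
  rw [← hcard]
  have hs : (Nat.card K - 1) / (Nat.card (ZMod p) - 1) = t * (Q + 1) := by
    rw [Nat.card_eq_fintype_card, Nat.card_eq_fintype_card, hK, ZMod.card]
    apply Nat.div_eq_of_eq_mul_left (by omega)
    obtain ⟨d, rfl⟩ : ∃ d, p = d + 1 := ⟨p - 1, by omega⟩
    rw [← ht]
    simp only [Nat.add_sub_cancel]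
    rw [Nat.sub_eq_iff_eq_add (by rw [Nat.one_le_iff_ne_zero]; positivity)]
    ring
  have hnorm : ∀ n : K, e (algebraMap (ZMod p) K (Algebra.norm (ZMod p) n)) = (e n) ^ (t * (Q + 1)) := by
    intro n
    rw [FiniteField.algebraMap_norm_eq_pow, hs, map_pow]
  have hfr : Module.finrank (ZMod p) K = μ + μ := by
    have h1 := Module.card_eq_pow_finrank (K := ZMod p) (V := K)
    rw [hK, ZMod.card, hQ, ← pow_add] at h1
    exact (Nat.pow_right_injective hpp.two_le h1).symm
  have htr : ∀ n : K, e (algebraMap (ZMod p) K (Algebra.trace (ZMod p) K n)) =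
      ∑ i ∈ range (μ + μ), (e n) ^ (p ^ i) := by
    intro n
    rw [FiniteField.algebraMap_trace_eq_sum_pow, hfr, map_sum]
    simp
  have hpow : ∀ (n : K) (w : L), w ^ p = w + e n → ∀ k, w ^ (p ^ k) = w + ∑ i ∈ range k, (e n) ^ (p ^ i) := by
    intro n w hw k
    induction k with
    | zero => simp
    | succ k ih =>
      rw [pow_succ, pow_mul, ih, add_pow_char, sum_pow_char, hw, Finset.sum_range_succ']
      simp only [← pow_mul, ← pow_succ]
      simp; ring
  refine stepanov (L := L) p hp3 μ Q t hμ hQ ht (e (algebraMap _ K b)) (e (algebraMap _ K a)) _ ?_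
  intro w hw
  rw [Finset.mem_biUnion] at hw
  obtain ⟨n, hn, hw⟩ := hw
  have hw := memT _ _ hw
  obtain ⟨h1, h2, h3, h4⟩ := hS n hn
  have hwn : w ^ p - w = e n := by rw [hw]; ring
  have hwn1 : w ^ p - w + 1 = e (n + 1) := by rw [hwn]; simp
  rw [hwn1, hwn]
  refine ⟨?_, ?_, ?_, ?_⟩
  · rw [← h4, htr, hQ, ← pow_add]
    exact hpow n w hw _
  · simpa using h1
  · exact fun h => h2 (e.injective (by rw [h, map_zero]))
  · rw [← hnorm, ← hnorm, h3]; simp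

lemma norm_sum_le_aux {Y : Type*} [Fintype Y] (θ : Y → ℂ) (M : Y → ℝ) (H : ℝ) (hθ : ∀ y, ‖θ y‖ ≤ 1)
    (h0 : ∑ y, θ y = 0) (hM : ∀ y, M y ≤ H) :
    ‖∑ y, θ y * (M y : ℂ)‖ ≤ Fintype.card Y * H - ∑ y, M y := by
  have : ∑ y, θ y * (M y : ℂ) = - ∑ y, θ y * ((H - M y : ℝ) : ℂ) := by
    push_cast
    simp only [mul_sub, Finset.sum_sub_distrib, ← Finset.sum_mul, h0]
    simp
  rw [this, norm_neg]
  calc _ ≤ ∑ y, ‖θ y * ((H - M y : ℝ) : ℂ)‖ := norm_sum_le _ _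
    _ ≤ ∑ y, (H - M y) := by
      apply Finset.sum_le_sum
      intro y _
      have hy := hM y
      rw [norm_mul, Complex.norm_real, Real.norm_eq_abs, abs_of_nonneg (by linarith)]
      exact mul_le_of_le_one_left (by linarith) (hθ y)
    _ = _ := by simp

lemma WK_bound (p : ℕ) [Fact p.Prime] (hp3 : 3 ≤ p) (χ : DirichletCharacter ℂ p) (hχ : χ ≠ 1)
    (ψ : AddChar (ZMod p) ℂ) 
    (K : Type) [Field K] [Fintype K] [Algebra (ZMod p) K]
    (μ : ℕ) (hμ : 1 ≤ μ) (hK : Fintype.card K = p ^ (2 * μ)) :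
    ‖WK p χ ψ K‖ ≤ (p * (2 * p + 10) + 2 : ℝ) * (p : ℝ) ^ μ := by
  classical
  have hpp : p.Prime := Fact.out
  set Q := p ^ μ with hQ
  have hK' : Fintype.card K = Q * Q := by rw [hK, hQ]; ring
  obtain ⟨t, ht⟩ : ∃ t, (p - 1) * t + 1 = Q := by
    have : p - 1 ∣ p ^ μ - 1 := by simpa using Nat.sub_dvd_pow_sub_pow p 1 μ
    obtain ⟨t, ht⟩ := this
    have := Nat.one_le_pow μ p hpp.pos
    exact ⟨t, by omega⟩
  let F : Type := ZMod p
  let N : K → ZMod p := fun n => Algebra.norm (ZMod p) n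
  have hN : ∀ n, n ≠ 0 → N n ≠ 0 := fun n hn => Algebra.norm_ne_zero_iff.2 hn
  let Y := (ZMod p)ˣ × ZMod p
  let A : Finset K := univ.filter (fun n => n ≠ 0 ∧ n + 1 ≠ 0)
  let cl : K → ZMod p × ZMod p := fun n => (N n / N (n + 1), Algebra.trace (ZMod p) K n)
  let M : Y → Finset K := fun y => A.filter (fun n => cl n = ((y.1 : ZMod p), y.2))
  let θ : Y → ℂ := fun y => χ (y.1 : ZMod p) * ψ y.2
  have hM : ∀ y, ((M y).card : ℝ) ≤ (t + 2 * p + 10) * Q / p := by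
    intro y
    have := class_bound p hp3 K μ Q t hμ hQ ht hK' (y.1 : ZMod p) y.2 (M y) (by
      intro n hn
      simp only [M, A, mem_filter, mem_univ, true_and, cl, Prod.mk.injEq] at hn
      obtain ⟨⟨h1, h2⟩, h3, h4⟩ := hn
      refine ⟨h1, h2, ?_, h4⟩
      rw [← h3]
      exact (div_mul_cancel₀ _ (hN _ h2)).symm)
    rw [le_div_iff₀ (by exact_mod_cast hpp.pos)]
    rw [mul_comm]
    exact_mod_cast this
  have hfib : ∀ (G : K → ℂ), ∑ n ∈ A, G n = ∑ y, ∑ n ∈ M y, G n := by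
    intro G
    rw [← Finset.sum_biUnion]
    · apply Finset.sum_congr _ (fun _ _ => rfl)
      ext n
      simp only [mem_biUnion, mem_univ, true_and, M, mem_filter]
      constructor
      · intro hn
        have hn' := hn
        simp only [A, mem_filter, mem_univ, true_and] at hn'
        refine ⟨(Units.mk0 _ (div_ne_zero (hN _ hn'.1) (hN _ hn'.2)), _), hn, rfl⟩
      · rintro ⟨y, hn, _⟩; exact hn
    · intro y _ y' _ hyy
      change Disjoint (M y) (M y')
      rw [Finset.disjoint_left]
      intro n hn hn'
      simp only [M, mem_filter] at hn hn'
      have := hn.2.symm.trans hn'.2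
      apply hyy
      simp only [Prod.mk.injEq] at this
      exact Prod.ext (Units.ext this.1) this.2
  have hW : WK p χ ψ K = ∑ y, θ y * (((M y).card : ℝ) : ℂ) := by
    have h1 : WK p χ ψ K = ∑ n ∈ A, χ (N n / N (n + 1)) * ψ (Algebra.trace (ZMod p) K n) := by
      rw [WK]
      symm
      rw [← Finset.sum_subset (Finset.subset_univ A)]
      · apply Finset.sum_congr rfl
        intro n hn
        congr 1
        rw [div_eq_mul_inv, map_mul]
        congr 1
        rw [← MulChar.inv_apply', ← MulChar.star_apply']
        rfl
      · intro n _ hn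
        simp only [A, mem_filter, mem_univ, true_and, not_and_or, not_not] at hn
        rcases hn with h | h
        · rw [h, Algebra.norm_zero, MulChar.map_zero]; simp
        · rw [h, Algebra.norm_zero, MulChar.map_zero]; simp
    rw [h1, hfib]
    apply Finset.sum_congr rfl
    intro y _
    rw [Finset.sum_congr rfl (g := fun _ => θ y)]
    · simp [mul_comm]
    · intro n hn
      simp only [M, mem_filter, cl, Prod.mk.injEq] at hn
      rw [hn.2.1, hn.2.2]
  have hsum : ∑ y, ((M y).card : ℝ) = A.card := by
    have := hfib (fun _ => 1)
    simp only [Finset.sum_const, nsmul_eq_mul, mul_one] at this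
    exact_mod_cast this.symm
  have hA : (Q * Q : ℝ) - 2 ≤ A.card := by
    have h1 : (univ : Finset K) ⊆ A ∪ {0, -1} := by
      intro n _
      simp only [A, mem_union, mem_filter, mem_univ, true_and, mem_insert, mem_singleton]
      by_cases h : n = 0
      · simp [h]
      · by_cases h' : n = -1
        · simp [h']
        · left; exact ⟨h, fun h2 => h' (eq_neg_of_add_eq_zero_left h2)⟩
    have h2 := (Finset.card_le_card h1).trans (Finset.card_union_le _ _)
    have h3 : ({0, -1} : Finset K).card ≤ 2 := Finset.card_le_two
    rw [Finset.card_univ, hK'] at h2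
    have : Q * Q ≤ A.card + 2 := by omega
    have : (Q * Q : ℝ) ≤ A.card + 2 := by exact_mod_cast this
    linarith
  have hθ0 : ∑ y, θ y = 0 := by
    have h1 : ∑ u : (ZMod p)ˣ, χ (u : ZMod p) = 0 := by
      obtain ⟨v, hv⟩ := MulChar.ne_one_iff.1 hχ
      have h2 : ∑ u : (ZMod p)ˣ, χ (u : ZMod p) = χ v * ∑ u : (ZMod p)ˣ, χ (u : ZMod p) := by
        rw [Finset.mul_sum]
        symm
        apply Fintype.sum_equiv (Equiv.mulLeft v)
        intro u
        simp
      by_contra h3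
      exact hv (mul_right_cancel₀ h3 (by rw [one_mul]; exact h2.symm))
    rw [Fintype.sum_prod_type]
    simp only [θ, ← Finset.mul_sum]
    rw [← Finset.sum_mul, h1, zero_mul]
  have hθ1 : ∀ y, ‖θ y‖ ≤ 1 := by
    intro y
    rw [norm_mul]
    rw [DirichletCharacter.unit_norm_eq_one, one_mul]
    exact (AddChar.norm_apply ψ _).le
  rw [hW]
  refine (norm_sum_le_aux θ (fun y => ((M y).card : ℝ)) _ hθ1 hθ0 hM).trans ?_
  rw [hsum]
  have hY : Fintype.card Y = (p - 1) * p := by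
    simp only [Y, Fintype.card_prod, ZMod.card, ZMod.card_units]
  rw [hY, Nat.cast_mul, Nat.cast_sub hpp.one_le]
  have hp0 : (p : ℝ) ≠ 0 := by exact_mod_cast hpp.ne_zero
  have ht' : ((p : ℝ) - 1) * t + 1 = Q := by
    have : (((p - 1) * t + 1 : ℕ) : ℝ) = Q := by rw [ht]
    rw [← this]; push_cast [Nat.cast_sub hpp.one_le]; ring
  have e1 : ((p : ℝ) - (1 : ℕ)) * p * ((t + 2 * p + 10) * Q / p) = (Q - 1) * Q + (p - 1) * (2 * p + 10) * Q := by
    rw [← ht']; field_simp; push_cast; ring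
  rw [e1]
  have hQ1 : (1 : ℝ) ≤ Q := by exact_mod_cast Nat.one_le_pow μ p hpp.pos
  have hQc : (p : ℝ) ^ μ = Q := by rw [hQ]; push_cast; rfl
  rw [hQc]
  have : (0 : ℝ) ≤ p := by positivity
  nlinarith
end WB


namespace WB
open Polynomial

lemma mon_finite (p : ℕ) [Fact p.Prime] (k : ℕ) :
    {g : (ZMod p)[X] | g.Monic ∧ g.natDegree = k}.Finite := by
  apply Set.Finite.of_injOn (f := fun g => fun i : Fin (k + 1) => g.coeff i)
    (t := (Set.univ : Set (Fin (k + 1) → ZMod p)))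
  · intro _ _; trivial
  · intro g hg g' hg' h
    ext i
    by_cases hi : i < k + 1
    · exact congrFun h ⟨i, hi⟩
    · rw [coeff_eq_zero_of_natDegree_lt (by rw [hg.2]; omega),
        coeff_eq_zero_of_natDegree_lt (by rw [hg'.2]; omega)]
  · exact Set.finite_univ

noncomputable def Mon (p : ℕ) [Fact p.Prime] (k : ℕ) : Finset (ZMod p)[X] := (mon_finite p k).toFinset

section
variable {p : ℕ} [Fact p.Prime]

lemma mem_Mon {k : ℕ} {g : (ZMod p)[X]} : g ∈ Mon p k ↔ g.Monic ∧ g.natDegree = k := by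
  simp [Mon]

variable (χ : DirichletCharacter ℂ p) (ψ : AddChar (ZMod p) ℂ)

noncomputable def lam (g : (ZMod p)[X]) : ℂ :=
  χ (g.eval 0) * (starRingEnd ℂ) (χ (g.eval (-1))) * ψ (-g.nextCoeff)

lemma lam_mul {f g : (ZMod p)[X]} (hf : f.Monic) (hg : g.Monic) :
    lam χ ψ (f * g) = lam χ ψ f * lam χ ψ g := by
  simp only [lam, eval_mul, map_mul, hf.nextCoeff_mul hg, neg_add, AddChar.map_add_eq_mul]
  ring

lemma lam_one : lam χ ψ 1 = 1 := by
  have h : (1 : (ZMod p)[X]).nextCoeff = 0 := by rw [← C_1, nextCoeff_C_eq_zero]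
  simp [lam, h]

lemma lam_pow {f : (ZMod p)[X]} (hf : f.Monic) (i : ℕ) :
    lam χ ψ (f ^ i) = lam χ ψ f ^ i := by
  induction i with
  | zero => simp [lam_one]
  | succ i ih => rw [pow_succ, lam_mul χ ψ (hf.pow i) hf, ih, pow_succ]

noncomputable def A (k : ℕ) : ℂ := ∑ g ∈ Mon p k, lam χ ψ g

lemma A_zero : A χ ψ 0 = 1 := by
  have : Mon p 0 = {1} := by
    ext g
    rw [mem_Mon, mem_singleton]
    constructor
    · rintro ⟨h1, h2⟩; exact h1.natDegree_eq_zero.1 h2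
    · rintro rfl; simp
  rw [A, this, sum_singleton, lam_one]

lemma A_one : A χ ψ 1 = ∑ n : ZMod p, χ n * (starRingEnd ℂ) (χ (n + 1)) * ψ n := by
  rw [A]
  symm
  apply Finset.sum_bij (fun n _ => X - C n)
  · intro n _
    rw [mem_Mon]; exact ⟨monic_X_sub_C n, natDegree_X_sub_C n⟩
  · intro n _ m _ h
    simpa using h
  · intro g hg
    rw [mem_Mon] at hg
    refine ⟨-g.coeff 0, mem_univ _, ?_⟩
    conv_rhs => rw [hg.1.eq_X_add_C hg.2]
    simp
  · intro n _
    have h1 : χ (-1) * (starRingEnd ℂ) (χ (-1)) = 1 := by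
      rw [Complex.mul_conj, Complex.normSq_eq_norm_sq]
      have := DirichletCharacter.unit_norm_eq_one χ (-1)
      simp only [Units.val_neg, Units.val_one] at this
      rw [this]; simp
    have h2 : (-1 - n : ZMod p) = (-1) * (n + 1) := by ring
    have h3 : (0 - n : ZMod p) = (-1) * n := by ring
    simp only [lam, eval_sub, eval_X, eval_C, nextCoeff_X_sub_C, neg_neg, h2, h3, map_mul]
    linear_combination (-χ n * (starRingEnd ℂ) (χ (n + 1)) * ψ n) * h1

lemma A_ge (hψ : ψ ≠ 1) {k : ℕ} (hk : 3 ≤ k) : A χ ψ k = 0 := by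
  obtain ⟨v, hv⟩ := AddChar.ne_one_iff.1 hψ
  obtain ⟨m, rfl⟩ : ∃ m, k = m + 3 := ⟨k - 3, by omega⟩
  let h : (ZMod p)[X] := C (-v) * (X ^ (m + 1) * (X + 1))
  have hh : h = C (-v) * X ^ (m + 2) + C (-v) * X ^ (m + 1) := by simp only [h]; ring
  have hdeg : ∀ c : ZMod p, (C c * h).natDegree ≤ m + 2 := by
    intro c
    refine (natDegree_C_mul_le _ _).trans ?_
    rw [hh]; compute_degree
  have hcoef : h.coeff (m + 2) = -v := by
    rw [hh]; simp [coeff_X_pow]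
  have key : ∀ (c : ZMod p), ∀ g ∈ Mon p (m + 3), g + C c * h ∈ Mon p (m + 3) := by
    intro c g hg
    rw [mem_Mon] at hg ⊢
    have hlt : (C c * h).natDegree < g.natDegree := by have := hdeg c; omega
    refine ⟨hg.1.add_of_left (degree_lt_degree hlt), ?_⟩
    rw [natDegree_add_eq_left_of_natDegree_lt hlt, hg.2]
  have e1 : A χ ψ (m + 3) = ψ v * A χ ψ (m + 3) := by
    rw [A, mul_sum]
    symm
    apply Finset.sum_nbij' (fun g => g + C 1 * h) (fun g => g + C (-1) * h) (key 1) (key (-1))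
    · intro g _; simp
    · intro g _; simp
    · intro g hg
      have hg' := mem_Mon.1 (key 1 g hg)
      have hg := mem_Mon.1 hg
      have n1 : (g + C 1 * h).nextCoeff = g.nextCoeff - v := by
        rw [nextCoeff_of_natDegree_pos (by omega), nextCoeff_of_natDegree_pos (by omega), hg'.2, hg.2,
          coeff_add]
        simp [hcoef, sub_eq_add_neg]
      simp only [lam, n1]
      have z0 : h.eval 0 = 0 := by simp [h]
      have z1 : h.eval (-1) = 0 := by simp [h]
      simp only [eval_add, eval_mul, z0, z1, mul_zero, add_zero, neg_sub, sub_eq_add_neg v,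
        AddChar.map_add_eq_mul]
      ring
  by_contra h3
  exact hv (mul_right_cancel₀ h3 (by rw [one_mul]; exact e1.symm))

open Classical in
noncomputable def Irr (p : ℕ) [Fact p.Prime] (e : ℕ) : Finset (ZMod p)[X] := (Mon p e).filter Irreducible

lemma mem_Irr {e : ℕ} {P : (ZMod p)[X]} : P ∈ Irr p e ↔ (P.Monic ∧ P.natDegree = e) ∧ Irreducible P := by
  simp [Irr, mem_Mon]

noncomputable def V (j : ℕ) : ℂ :=
  ∑ e ∈ j.divisors, ∑ P ∈ Irr p e, (e : ℂ) * lam χ ψ P ^ (j / e)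

open scoped Classical in
open UniqueFactorizationMonoid in
lemma degree_count {k : ℕ} {g : (ZMod p)[X]} (hg : g ∈ Mon p k) :
    (k : ℂ) = ∑ e ∈ Icc 1 k, ∑ P ∈ Irr p e, ∑ i ∈ Icc 1 k, if P ^ i ∣ g then (e : ℂ) else 0 := by
  rw [mem_Mon] at hg
  have hg0 : g ≠ 0 := hg.1.ne_zero
  have hnf : (normalizedFactors g).prod = g := by
    rw [prod_normalizedFactors_eq hg0, hg.1.normalize_eq_self]
  have hd : (k : ℂ) = ∑ P ∈ (normalizedFactors g).toFinset, ((normalizedFactors g).count P : ℂ) * P.natDegree := by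
    have h1 : g.natDegree = ((normalizedFactors g).map natDegree).sum := by
      conv_lhs => rw [← hnf]
      apply natDegree_multiset_prod
      exact zero_notMem_normalizedFactors g
    rw [← hg.2, h1, Finset.sum_multiset_map_count]
    push_cast
    simp
  have hcount : ∀ P : (ZMod p)[X], P.Monic → Irreducible P → ∀ i, P ^ i ∣ g ↔ i ≤ (normalizedFactors g).count P := by
    intro P hP hPi i
    rw [dvd_iff_normalizedFactors_le_normalizedFactors (pow_ne_zero _ hP.ne_zero) hg0,
      normalizedFactors_pow, normalizedFactors_irreducible hPi, hP.normalize_eq_self,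
      Multiset.nsmul_singleton, Multiset.le_count_iff_replicate_le]
  have hck : ∀ P : (ZMod p)[X], P.Monic → Irreducible P → (normalizedFactors g).count P ≤ k := by
    intro P hP hPi
    have h1 := natDegree_le_of_dvd ((hcount P hP hPi _).2 le_rfl) hg0
    rw [hP.natDegree_pow, hg.2] at h1
    exact le_trans (Nat.le_mul_of_pos_right _ hPi.natDegree_pos) h1
  have h2 : ∀ e ∈ Icc 1 k, ∀ P ∈ Irr p e, (∑ i ∈ Icc 1 k, if P ^ i ∣ g then (e : ℂ) else 0) =
      ((normalizedFactors g).count P : ℂ) * P.natDegree := by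
    intro e _ P hP
    rw [mem_Irr] at hP
    rw [← Finset.sum_filter, Finset.sum_const, hP.1.2, nsmul_eq_mul]
    congr 2
    have : (Icc 1 k).filter (fun i => P ^ i ∣ g) = Icc 1 ((normalizedFactors g).count P) := by
      ext i
      simp only [mem_filter, mem_Icc, hcount P hP.1.1 hP.2]
      have := hck P hP.1.1 hP.2
      omega
    rw [this]; simp
  rw [Finset.sum_congr rfl (fun e he => Finset.sum_congr rfl (h2 e he)), hd]
  rw [← Finset.sum_biUnion]
  · apply Finset.sum_subset
    · intro P hP
      rw [Multiset.mem_toFinset] at hP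
      have hi := irreducible_of_normalized_factor P hP
      have hm : P.Monic := by
        rw [← normalize_normalized_factor P hP]
        exact monic_normalize hi.ne_zero
      rw [mem_biUnion]
      refine ⟨P.natDegree, ?_, mem_Irr.2 ⟨⟨hm, rfl⟩, hi⟩⟩
      rw [mem_Icc]
      refine ⟨hi.natDegree_pos, ?_⟩
      rw [← hg.2]
      exact natDegree_le_of_dvd (dvd_of_mem_normalizedFactors hP) hg0
    · intro P _ hP
      rw [Multiset.mem_toFinset] at hP
      rw [Multiset.count_eq_zero_of_notMem hP]; simp
  · intro e _ e' _ hee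
    change Disjoint _ _
    rw [Finset.disjoint_left]
    intro P h1 h2
    exact hee ((mem_Irr.1 h1).1.2.symm.trans (mem_Irr.1 h2).1.2)

open scoped Classical in
lemma sum_dvd {k e i : ℕ} {P : (ZMod p)[X]} (hP : P.Monic) (hd : P.natDegree = e) (hk : i * e ≤ k) :
    ∑ g ∈ Mon p k, (if P ^ i ∣ g then lam χ ψ g else 0) = lam χ ψ P ^ i * A χ ψ (k - i * e) := by
  rw [← Finset.sum_filter, A, mul_sum]
  symm
  have hPi : (P ^ i).Monic := hP.pow i
  have hPd : (P ^ i).natDegree = i * e := by rw [hP.natDegree_pow, hd]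
  apply Finset.sum_bij (fun g _ => P ^ i * g)
  · intro g hg
    rw [mem_Mon] at hg
    rw [mem_filter, mem_Mon]
    refine ⟨⟨hPi.mul hg.1, ?_⟩, Dvd.intro _ rfl⟩
    rw [hPi.natDegree_mul hg.1, hPd, hg.2]; omega
  · intro g _ g' _ h
    exact mul_left_cancel₀ hPi.ne_zero h
  · intro g hg
    rw [mem_filter, mem_Mon] at hg
    obtain ⟨⟨h1, h2⟩, ⟨f, rfl⟩⟩ := hg
    have hf : f.Monic := hPi.of_mul_monic_left h1
    refine ⟨f, ?_, rfl⟩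
    rw [mem_Mon]
    refine ⟨hf, ?_⟩
    rw [hPi.natDegree_mul hf, hPd] at h2
    omega
  · intro g hg
    rw [mem_Mon] at hg
    rw [lam_mul χ ψ hPi hg.1, lam_pow χ ψ hP]

open scoped Classical in
lemma sum_not_dvd {k e i : ℕ} {P : (ZMod p)[X]} (hP : P.Monic) (hd : P.natDegree = e) (hk : ¬ i * e ≤ k) :
    ∑ g ∈ Mon p k, (if P ^ i ∣ g then lam χ ψ g else 0) = 0 := by
  apply Finset.sum_eq_zero
  intro g hg
  rw [mem_Mon] at hg
  rw [if_neg]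
  intro h
  have := natDegree_le_of_dvd h hg.1.ne_zero
  rw [hP.natDegree_pow, hd, hg.2] at this
  exact hk this

lemma newton (k : ℕ) : (k : ℂ) * A χ ψ k = ∑ j ∈ Icc 1 k, V χ ψ j * A χ ψ (k - j) := by
  classical
  have h1 : (k : ℂ) * A χ ψ k = ∑ e ∈ Icc 1 k, ∑ P ∈ Irr p e, ∑ i ∈ Icc 1 k,
      if i * e ≤ k then (e : ℂ) * lam χ ψ P ^ i * A χ ψ (k - i * e) else 0 := by
    calc (k : ℂ) * A χ ψ k = ∑ g ∈ Mon p k, ∑ e ∈ Icc 1 k, ∑ P ∈ Irr p e, ∑ i ∈ Icc 1 k,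
            (e : ℂ) * if P ^ i ∣ g then lam χ ψ g else 0 := by
          rw [A, mul_sum]
          apply Finset.sum_congr rfl
          intro g hg
          rw [degree_count hg]
          simp only [Finset.sum_mul]
          refine Finset.sum_congr rfl fun e _ => Finset.sum_congr rfl fun P _ => Finset.sum_congr rfl fun i _ => ?_
          split_ifs <;> simp
      _ = _ := by
          rw [Finset.sum_comm]
          refine Finset.sum_congr rfl fun e _ => ?_
          rw [Finset.sum_comm]
          refine Finset.sum_congr rfl fun P hP => ?_
          rw [Finset.sum_comm]
          refine Finset.sum_congr rfl fun i _ => ?_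
          rw [← mul_sum]
          rw [mem_Irr] at hP
          split_ifs with h
          · rw [sum_dvd χ ψ hP.1.1 hP.1.2 h]; ring
          · rw [sum_not_dvd χ ψ hP.1.1 hP.1.2 h]; ring
  have h2 : ∑ j ∈ Icc 1 k, V χ ψ j * A χ ψ (k - j) = ∑ j ∈ Icc 1 k, ∑ e ∈ Icc 1 k, ∑ P ∈ Irr p e,
      if e ∣ j then (e : ℂ) * lam χ ψ P ^ (j / e) * A χ ψ (k - j) else 0 := by
    apply Finset.sum_congr rfl
    intro j hj
    rw [mem_Icc] at hj
    have : j.divisors = (Icc 1 k).filter (· ∣ j) := by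
      ext e
      rw [Nat.mem_divisors, mem_filter, mem_Icc]
      constructor
      · rintro ⟨h, h0⟩
        exact ⟨⟨Nat.pos_of_dvd_of_pos h (by omega), (Nat.le_of_dvd (by omega) h).trans hj.2⟩, h⟩
      · rintro ⟨_, h⟩; exact ⟨h, by omega⟩
    rw [V, this, Finset.sum_filter, Finset.sum_mul]
    refine Finset.sum_congr rfl fun e _ => ?_
    split_ifs with h
    · rw [Finset.sum_mul]
    · simp
  rw [h1, h2, Finset.sum_comm]
  refine Finset.sum_congr rfl fun e he => ?_
  refine Eq.trans ?_ Finset.sum_comm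
  refine Finset.sum_congr rfl fun P _ => ?_
  rw [← Finset.sum_filter, ← Finset.sum_filter]
  rw [mem_Icc] at he
  apply Finset.sum_bij (fun i _ => i * e)
  · intro i hi
    simp only [mem_filter, mem_Icc] at hi ⊢
    exact ⟨⟨Nat.mul_pos (by omega) (by omega), hi.2⟩, Dvd.intro_left _ rfl⟩
  · intro i _ i' _ h
    exact Nat.eq_of_mul_eq_mul_right (by omega) h
  · intro j hj
    simp only [mem_filter, mem_Icc] at hj
    obtain ⟨hj, ⟨i, rfl⟩⟩ := hj
    refine ⟨i, ?_, by ring⟩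
    simp only [mem_filter, mem_Icc]
    have : 1 ≤ i := by
      rcases Nat.eq_zero_or_pos i with h | h
      · subst h; omega
      · exact h
    refine ⟨⟨this, ?_⟩, by rw [mul_comm]; exact hj.2⟩
    exact le_trans (Nat.le_mul_of_pos_left i (by omega)) hj.2
  · intro i _
    rw [Nat.mul_div_cancel i (by omega)]

lemma chi_pm (ε : ZMod p) (hε : ε ≠ 0) : χ ε * (starRingEnd ℂ) (χ ε) = 1 := by
  rw [Complex.mul_conj, Complex.normSq_eq_norm_sq]
  have := DirichletCharacter.unit_norm_eq_one χ (Units.mk0 ε hε)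
  simp only [Units.val_mk0] at this
  rw [this]; simp

open IntermediateField in
lemma finrank_mul (K : Type) [Field K] [Fintype K] [Algebra (ZMod p) K] (n : K) :
    (minpoly (ZMod p) n).natDegree * Module.finrank (ZMod p)⟮n⟯ K = Module.finrank (ZMod p) K := by
  rw [← IntermediateField.adjoin.finrank (Algebra.IsIntegral.isIntegral n)]
  exact Module.finrank_mul_finrank _ _ _

lemma norm_minpoly (K : Type) [Field K] [Fintype K] [Algebra (ZMod p) K] (n : K) :
    Algebra.norm (ZMod p) n = ((-1) ^ (minpoly (ZMod p) n).natDegree * (minpoly (ZMod p) n).eval 0) ^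
      (Module.finrank (ZMod p) K / (minpoly (ZMod p) n).natDegree) := by
  have hint : IsIntegral (ZMod p) n := Algebra.IsIntegral.isIntegral n
  rw [← finrank_mul K n, Nat.mul_div_cancel_left _ (minpoly.natDegree_pos hint),
    Algebra.norm_eq_norm_adjoin]
  congr 1
  have := Algebra.PowerBasis.norm_gen_eq_coeff_zero_minpoly (IntermediateField.adjoin.powerBasis hint)
  rw [IntermediateField.adjoin.powerBasis_gen, IntermediateField.minpoly_gen,
    IntermediateField.adjoin.powerBasis_dim, coeff_zero_eq_eval_zero] at this
  exact this

lemma term_eq (K : Type) [Field K] [Fintype K] [Algebra (ZMod p) K] (n : K) :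
    χ (Algebra.norm (ZMod p) n) * (starRingEnd ℂ) (χ (Algebra.norm (ZMod p) (n + 1))) *
      ψ (Algebra.trace (ZMod p) K n) = lam χ ψ (minpoly (ZMod p) n) ^
      (Module.finrank (ZMod p) K / (minpoly (ZMod p) n).natDegree) := by
  have hint : IsIntegral (ZMod p) n := Algebra.IsIntegral.isIntegral n
  have h1 : minpoly (ZMod p) (n + 1) = (minpoly (ZMod p) n).comp (X - C 1) := by
    have := minpoly.add_algebraMap n (1 : ZMod p)
    rwa [map_one] at this
  have h2 : (minpoly (ZMod p) (n + 1)).natDegree = (minpoly (ZMod p) n).natDegree := by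
    rw [h1, natDegree_comp, natDegree_X_sub_C, mul_one]
  have h3 : (minpoly (ZMod p) (n + 1)).eval 0 = (minpoly (ZMod p) n).eval (-1) := by
    rw [h1, eval_comp]; simp
  rw [norm_minpoly, norm_minpoly, h2, h3, trace_eq_finrank_mul_minpoly_nextCoeff]
  have h4 := finrank_mul (p := p) K n
  have h5 := minpoly.natDegree_pos hint
  have h6 : Module.finrank (ZMod p) K / (minpoly (ZMod p) n).natDegree =
      Module.finrank (IntermediateField.adjoin (ZMod p) {n}) K := by
    rw [← h4, Nat.mul_div_cancel_left _ h5]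
  rw [h6, ← nsmul_eq_mul, AddChar.map_nsmul_eq_pow, map_pow, map_pow, map_pow, ← mul_pow, ← mul_pow]
  congr 1
  rw [lam, map_mul, map_mul, map_mul]
  have h7 := chi_pm χ ((-1) ^ (minpoly (ZMod p) n).natDegree) (by simp)
  linear_combination (χ (eval 0 (minpoly (ZMod p) n)) * (starRingEnd ℂ) (χ (eval (-1) (minpoly (ZMod p) n)))
    * ψ (-(minpoly (ZMod p) n).nextCoeff)) * h7

lemma V_eq_WK (K : Type) [Field K] [Fintype K] [Algebra (ZMod p) K] (j : ℕ) (hj : 1 ≤ j)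
    (hK : Fintype.card K = p ^ j) : V χ ψ j = WK p χ ψ K := by
  classical
  have hpp : p.Prime := Fact.out
  have hfr : Module.finrank (ZMod p) K = j := by
    have h1 := Module.card_eq_pow_finrank (K := ZMod p) (V := K)
    rw [hK, ZMod.card] at h1
    exact (Nat.pow_right_injective hpp.two_le h1).symm
  rw [WK, Finset.sum_congr rfl (fun n _ => term_eq χ ψ K n), hfr, V]
  have hint : ∀ n : K, IsIntegral (ZMod p) n := fun n => Algebra.IsIntegral.isIntegral n
  rw [← Finset.sum_fiberwise_of_maps_to (s := (univ : Finset K)) (t := j.divisors)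
    (g := fun n => (minpoly (ZMod p) n).natDegree)]
  swap
  · intro n _
    rw [Nat.mem_divisors]
    refine ⟨?_, by omega⟩
    rw [← hfr]
    exact Dvd.intro _ (finrank_mul K n)
  refine Finset.sum_congr rfl fun e he => ?_
  rw [← Finset.sum_fiberwise_of_maps_to (s := univ.filter (fun n : K => (minpoly (ZMod p) n).natDegree = e))
    (t := Irr p e) (g := fun n => minpoly (ZMod p) n)]
  swap
  · intro n hn
    rw [mem_filter] at hn
    exact mem_Irr.2 ⟨⟨minpoly.monic (hint n), hn.2⟩, minpoly.irreducible (hint n)⟩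
  refine Finset.sum_congr rfl fun P hP => ?_
  rw [mem_Irr] at hP
  obtain ⟨⟨hm, hd⟩, hi⟩ := hP
  have hset : ((univ.filter (fun n : K => (minpoly (ZMod p) n).natDegree = e)).filter
      (fun n => minpoly (ZMod p) n = P)) = (P.aroots K).toFinset := by
    ext n
    simp only [mem_filter, mem_univ, true_and, Multiset.mem_toFinset]
    rw [mem_aroots]
    constructor
    · rintro ⟨_, h⟩
      exact ⟨hm.ne_zero, by rw [← h]; exact minpoly.aeval _ _⟩
    · rintro ⟨_, h⟩
      have := minpoly.eq_of_irreducible_of_monic hi h hm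
      rw [← this]; exact ⟨hd, rfl⟩
  have hsep : (P.map (algebraMap (ZMod p) K)).Separable :=
    (PerfectField.separable_of_irreducible hi).map
  have hspl : (P.map (algebraMap (ZMod p) K)).Splits := by
    refine Splits.of_dvd (FiniteField.splits_X_pow_card_sub_X p) ?_ (Polynomial.map_dvd _ ?_)
    · exact map_ne_zero (FiniteField.X_pow_card_sub_X_ne_zero _ Fintype.one_lt_card)
    · have := (hi.natDegree_dvd_iff_dvd_X_pow_card_pow_sub_X (n := j)).1
        (by rw [hd]; exact Nat.dvd_of_mem_divisors he)
      rwa [Nat.card_eq_fintype_card, ZMod.card, ← hK] at this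
  have hcard : (P.aroots K).toFinset.card = e := by
    rw [aroots, Multiset.toFinset_card_of_nodup (nodup_roots hsep), splits_iff_card_roots.1 hspl,
      natDegree_map, hd]
  rw [Finset.sum_congr rfl (g := fun _ => lam χ ψ P ^ (j / e))]
  · rw [Finset.sum_const, hset, hcard, nsmul_eq_mul]
  · intro n hn
    rw [mem_filter] at hn
    rw [hn.2, hd]
end
end WB

namespace WB

lemma pow_bound_imp (α β : ℂ) (C r : ℝ) (hr : 0 < r)
    (h : ∀ m : ℕ, 1 ≤ m → ‖α ^ m + β ^ m‖ ≤ C * r ^ m) : ‖α‖ ≤ r := by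
  have hgrow : ∀ (x D : ℝ), 0 ≤ x → (∀ m : ℕ, 1 ≤ m → x ^ m ≤ D * r ^ m) → x ≤ r := by
    intro x D hx hm
    by_contra hlt
    push Not at hlt
    have h1 : 1 < x / r := (one_lt_div hr).2 hlt
    obtain ⟨m, hm'⟩ := pow_unbounded_of_one_lt D h1
    have h2 : (x / r) ^ (m + 1) ≤ D := by
      rw [div_pow, div_le_iff₀ (pow_pos hr _)]
      exact hm (m + 1) (by omega)
    have h3 : (x / r) ^ m ≤ (x / r) ^ (m + 1) := pow_le_pow_right₀ h1.le (by omega)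
    linarith
  have hprod : ‖α * β‖ ≤ r ^ 2 := by
    by_contra hlt
    push Not at hlt
    have h1 : 1 < ‖α * β‖ / r ^ 2 := (one_lt_div (by positivity)).2 hlt
    obtain ⟨m, hm'⟩ := pow_unbounded_of_one_lt ((C ^ 2 + C) / 2) h1
    have h2 : (‖α * β‖ / r ^ 2) ^ (m + 1) ≤ (C ^ 2 + C) / 2 := by
      rw [div_pow, div_le_iff₀ (by positivity)]
      have e1 : 2 * (α * β) ^ (m + 1) = (α ^ (m + 1) + β ^ (m + 1)) ^ 2 -
          (α ^ (2 * (m + 1)) + β ^ (2 * (m + 1))) := by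
        rw [mul_pow]; ring
      have e2 : 2 * ‖α * β‖ ^ (m + 1) = ‖2 * (α * β) ^ (m + 1)‖ := by
        simp only [norm_mul, norm_pow, Complex.norm_ofNat]
      have h3 := h (m + 1) (by omega)
      have h4 := h (2 * (m + 1)) (by omega)
      have h5 : ‖2 * (α * β) ^ (m + 1)‖ ≤ ‖α ^ (m + 1) + β ^ (m + 1)‖ ^ 2 +
          ‖α ^ (2 * (m + 1)) + β ^ (2 * (m + 1))‖ := by
        rw [e1, ← norm_pow]; exact norm_sub_le _ _
      have h6 : ‖α ^ (m + 1) + β ^ (m + 1)‖ ^ 2 ≤ (C * r ^ (m + 1)) ^ 2 :=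
        pow_le_pow_left₀ (norm_nonneg _) h3 2
      have e3 : (r ^ 2) ^ (m + 1) = (r ^ (m + 1)) ^ 2 := by ring
      have e4 : r ^ (2 * (m + 1)) = (r ^ (m + 1)) ^ 2 := by ring
      rw [e3]
      rw [e4] at h4
      nlinarith
    have h3 : (‖α * β‖ / r ^ 2) ^ m ≤ (‖α * β‖ / r ^ 2) ^ (m + 1) := pow_le_pow_right₀ h1.le (by omega)
    linarith
  by_contra hlt
  push Not at hlt
  have hβ : ‖β‖ ≤ r := by
    rw [norm_mul] at hprod
    by_contra hb
    push Not at hb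
    nlinarith
  apply absurd (hgrow ‖α‖ (C + 1) (norm_nonneg _) ?_) (not_le.2 hlt)
  intro m hm
  have h1 := h m hm
  have h2 : ‖α ^ m‖ ≤ ‖α ^ m + β ^ m‖ + ‖β ^ m‖ := by
    have := norm_sub_le (α ^ m + β ^ m) (β ^ m)
    simpa using this
  rw [norm_pow, norm_pow] at h2
  have h3 : ‖β‖ ^ m ≤ r ^ m := pow_le_pow_left₀ (norm_nonneg _) hβ m
  linarith

lemma exists_roots (s q : ℂ) : ∃ α β : ℂ, α + β = s ∧ α * β = q := by
  obtain ⟨z, hz⟩ := IsAlgClosed.exists_pow_nat_eq (s ^ 2 - 4 * q) (n := 2) (by norm_num)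
  exact ⟨(s + z) / 2, (s - z) / 2, by ring, by linear_combination -hz / 4⟩

section
variable {p : ℕ} [Fact p.Prime] (χ : DirichletCharacter ℂ p) (ψ : AddChar (ZMod p) ℂ)

lemma V_rec (hψ : ψ ≠ 1) (k : ℕ) :
    V χ ψ (k + 3) + V χ ψ (k + 2) * A χ ψ 1 + V χ ψ (k + 1) * A χ ψ 2 = 0 := by
  have h := newton χ ψ (k + 3)
  rw [A_ge χ ψ hψ (by omega), mul_zero, Finset.sum_Icc_succ_top (by omega),
    Finset.sum_Icc_succ_top (by omega), Finset.sum_Icc_succ_top (by omega)] at h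
  rw [Finset.sum_eq_zero] at h
  · have e1 : k + 3 - (k + 1) = 2 := by omega
    have e2 : k + 3 - (k + 2) = 1 := by omega
    simp only [show k + 0 + 1 = k + 1 by rfl, show k + 1 + 1 = k + 2 by rfl, show k + 2 + 1 = k + 3 by rfl,
      e1, e2, Nat.sub_self, A_zero] at h
    linear_combination -h
  · intro j hj
    rw [mem_Icc] at hj
    rw [A_ge χ ψ hψ (by omega), mul_zero]

lemma V_one : V χ ψ 1 = A χ ψ 1 := by
  have h := newton χ ψ 1
  simp [A_zero] at h
  exact h.symm

lemma V_two : V χ ψ 2 = 2 * A χ ψ 2 - A χ ψ 1 ^ 2 := by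
  have h := newton χ ψ 2
  rw [Finset.sum_Icc_succ_top (by omega)] at h
  simp [A_zero, V_one] at h
  linear_combination -h

lemma A_one_bound (hp3 : 3 ≤ p) (hχ : χ ≠ 1) (hψ : ψ ≠ 1) : ‖A χ ψ 1‖ ≤ 2 * Real.sqrt p := by
  have hpp : p.Prime := Fact.out
  obtain ⟨α, β, h1, h2⟩ := exists_roots (-A χ ψ 1) (A χ ψ 2)
  have hV : ∀ k, V χ ψ (k + 1) = -(α ^ (k + 1) + β ^ (k + 1)) := by
    intro k
    induction k using Nat.strong_induction_on with
    | _ k ih =>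
      match k, ih with
      | 0, _ => rw [zero_add, V_one]; linear_combination -h1 * (-1)
      | 1, _ =>
        rw [V_two]
        have : A χ ψ 1 = -(α + β) := by rw [h1, neg_neg]
        rw [← h2, this]; ring
      | (k + 2), ih =>
        have e1 := ih k (by omega)
        have e2 := ih (k + 1) (by omega)
        have e3 := V_rec χ ψ hψ k
        have : A χ ψ 1 = -(α + β) := by rw [h1, neg_neg]
        rw [e1, e2, ← h2, this] at e3
        linear_combination e3
  have hb : ∀ m : ℕ, 1 ≤ m → ‖(α ^ 2) ^ m + (β ^ 2) ^ m‖ ≤ (p * (2 * p + 10) + 2 : ℝ) * (p : ℝ) ^ m := by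
    intro m hm
    have : Fintype (GaloisField p (2 * m)) := Fintype.ofFinite _
    have hc : Fintype.card (GaloisField p (2 * m)) = p ^ (2 * m) := by
      rw [Fintype.card_eq_nat_card]; exact GaloisField.card p _ (by omega)
    have h3 := WK_bound p hp3 χ hχ ψ (GaloisField p (2 * m)) m hm hc
    rw [← V_eq_WK χ ψ (GaloisField p (2 * m)) (2 * m) (by omega) hc] at h3
    have h4 := hV (2 * m - 1)
    rw [Nat.sub_add_cancel (by omega)] at h4
    rw [h4, norm_neg] at h3
    rwa [← pow_mul, ← pow_mul]
  have hp0 : (0 : ℝ) < p := by exact_mod_cast hpp.pos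
  have ha := pow_bound_imp _ _ _ _ hp0 hb
  have hb' := pow_bound_imp _ _ _ _ hp0 (fun m hm => by rw [add_comm]; exact hb m hm)
  rw [norm_pow] at ha hb'
  have ha := Real.le_sqrt_of_sq_le ha
  have hb' := Real.le_sqrt_of_sq_le hb'
  calc ‖A χ ψ 1‖ = ‖α + β‖ := by rw [h1, norm_neg]
    _ ≤ ‖α‖ + ‖β‖ := norm_add_le _ _
    _ ≤ _ := by linarith

lemma Wsum_eq (h x : ℤ) : Wsum χ h x = ∑ n : ZMod p, χ n * (starRingEnd ℂ) (χ (n + (h : ZMod p))) *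
    ZMod.stdAddChar (n * (x : ZMod p)) := by
  have : NeZero p := ⟨(Fact.out : p.Prime).ne_zero⟩
  rw [Wsum]
  apply Finset.sum_bij (fun (n : ℕ) _ => (n : ZMod p))
  · intro _ _; exact mem_univ _
  · intro a ha b hb hab
    rw [mem_range] at ha hb
    have := congrArg ZMod.val hab
    rwa [ZMod.val_cast_of_lt ha, ZMod.val_cast_of_lt hb] at this
  · intro b _
    exact ⟨b.val, mem_range.2 (ZMod.val_lt b), ZMod.natCast_zmod_val b⟩
  · intro n _
    congr 1
    have := ZMod.stdAddChar_coe (N := p) ((n : ℤ) * x)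
    push_cast at this
    rw [this]
    congr 1
    ring

lemma norm_chi_conj_le (a b : ZMod p) : ‖χ a * (starRingEnd ℂ) (χ b)‖ ≤ 1 := by
  rw [norm_mul, RCLike.norm_conj]
  exact mul_le_one₀ (DirichletCharacter.norm_le_one χ _) (norm_nonneg _) (DirichletCharacter.norm_le_one χ _)

lemma chi_conj (a b : ZMod p) : χ a * (starRingEnd ℂ) (χ b) = χ (a / b) := by
  rw [div_eq_mul_inv, map_mul, ← MulChar.inv_apply', ← MulChar.star_apply']; rfl

lemma three_le (hχ : χ ≠ 1) : 3 ≤ p := by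
  have hpp : p.Prime := Fact.out
  by_contra hlt
  have h2 : p = 2 := by have := hpp.two_le; omega
  subst h2
  apply hχ
  ext u
  have : u = 1 := Subsingleton.elim _ _
  rw [this]; simp

lemma main_bound (hχ : χ ≠ 1) (h x : ℤ) (hhx : ¬ (p : ℤ) ∣ h ∨ ¬ (p : ℤ) ∣ x) :
    ‖Wsum χ h x‖ ≤ 2 * Real.sqrt p := by
  classical
  have hpp : p.Prime := Fact.out
  have : NeZero p := ⟨hpp.ne_zero⟩
  have hs1 : (1 : ℝ) ≤ Real.sqrt p := by
    rw [Real.one_le_sqrt]; exact_mod_cast hpp.one_le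
  rw [Wsum_eq]
  rw [← ZMod.intCast_zmod_eq_zero_iff_dvd, ← ZMod.intCast_zmod_eq_zero_iff_dvd] at hhx
  set H : ZMod p := (h : ZMod p)
  set Z : ZMod p := (x : ZMod p)
  by_cases hH : H = 0
  · have hZ : Z ≠ 0 := by tauto
    have e1 : ∑ n : ZMod p, χ n * (starRingEnd ℂ) (χ (n + H)) * ZMod.stdAddChar (n * Z) = -1 := by
      have e2 : ∑ n : ZMod p, (ZMod.stdAddChar (n * Z) : ℂ) = 0 := by
        have := AddChar.sum_mulShift Z (ZMod.isPrimitive_stdAddChar p)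
        rw [if_neg hZ] at this
        exact_mod_cast this
      have e3 : ∀ n : ZMod p, χ n * (starRingEnd ℂ) (χ (n + H)) * ZMod.stdAddChar (n * Z) =
          ZMod.stdAddChar (n * Z) - if n = 0 then 1 else 0 := by
        intro n
        rw [hH, add_zero]
        split_ifs with hn
        · rw [hn, MulChar.map_zero]; simp
        · rw [chi_pm χ n hn]; simp
      rw [Finset.sum_congr rfl (fun n _ => e3 n), Finset.sum_sub_distrib, e2]
      simp
    rw [e1]; simp; linarith
  -- substitution `n = H * m`
  have e1 : ∑ n : ZMod p, χ n * (starRingEnd ℂ) (χ (n + H)) * ZMod.stdAddChar (n * Z) =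
      ∑ n : ZMod p, χ n * (starRingEnd ℂ) (χ (n + 1)) * ZMod.stdAddChar (H * Z * n) := by
    symm
    apply Fintype.sum_equiv (Equiv.mulLeft₀ H hH)
    intro n
    simp only [Equiv.mulLeft₀_apply]
    rw [chi_conj, chi_conj]
    congr 2
    · rw [show H * n + H = H * (n + 1) by ring, mul_div_mul_left _ _ hH]
    · ring
  rw [e1]
  by_cases hZ : Z = 0
  · simp only [hZ, mul_zero, zero_mul, AddChar.map_zero_eq_one, mul_one]
    have e2 : ∑ n : ZMod p, χ n * (starRingEnd ℂ) (χ (n + 1)) = -1 := by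
      have e3 : ∑ m : ZMod p, χ m = 0 := MulChar.sum_eq_zero_of_ne_one hχ
      have e4 : ∑ k : ZMod p, χ (1 - k⁻¹) = 0 := by
        rw [← e3]
        exact Fintype.sum_equiv ((inv_involutive (G := ZMod p)).toPerm.trans (Equiv.subLeft 1)) _ _ (fun k => rfl)
      have e5 : ∑ n : ZMod p, χ n * (starRingEnd ℂ) (χ (n + 1)) =
          ∑ k : ZMod p, (χ (1 - k⁻¹) - if k = 0 then 1 else 0) := by
        apply Fintype.sum_equiv (Equiv.addRight (1 : ZMod p))
        intro n
        change _ = χ (1 - (n + 1)⁻¹) - if n + 1 = 0 then 1 else 0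
        rw [chi_conj]
        by_cases hn : n + 1 = 0
        · rw [if_pos hn, hn]; simp [MulChar.map_zero χ]
        · rw [if_neg hn, sub_zero]
          congr 1
          field_simp
          ring
      rw [e5, Finset.sum_sub_distrib, e4]
      simp
    rw [e2]; simp; linarith
  · have hψ : AddChar.mulShift (ZMod.stdAddChar (N := p)) (H * Z) ≠ 1 :=
      ZMod.isPrimitive_stdAddChar p (mul_ne_zero hH hZ)
    have := A_one_bound χ _ (three_le χ hχ) hχ hψ
    rw [A_one] at this
    simpa only [AddChar.mulShift_apply] using this
end
end WB

/-- Weil-type bound for `W_{χ,h}(x)` to a prime modulus: for a nontrivial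
(i.e. primitive) character `χ` mod a prime `p`,
`|W_{χ,h}(x)| ≪ p^{1/2} gcd(h,x,p)^{1/2}` with an absolute constant; in
particular `|W_{χ,h}(x)| ≪ √p` when `p ∤ h` or `p ∤ x`. -/
theorem Wsum_prime_bound :
    ∃ C : ℝ, 0 < C ∧
      ∀ p : ℕ, p.Prime → ∀ χ : DirichletCharacter ℂ p, χ ≠ 1 → ∀ h x : ℤ,
        ‖Wsum χ h x‖ ≤ C * Real.sqrt p * Real.sqrt (Int.gcd h (Int.gcd x p)) ∧
        ((¬ (p : ℤ) ∣ h ∨ ¬ (p : ℤ) ∣ x) → ‖Wsum χ h x‖ ≤ C * Real.sqrt p) := by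
  refine ⟨2, by norm_num, ?_⟩
  intro p hp χ hχ h x
  have : Fact p.Prime := ⟨hp⟩
  refine ⟨?_, WB.main_bound χ hχ h x⟩
  by_cases hhx : ¬ (p : ℤ) ∣ h ∨ ¬ (p : ℤ) ∣ x
  · refine (WB.main_bound χ hχ h x hhx).trans ?_
    apply le_mul_of_one_le_right (by positivity)
    rw [Real.one_le_sqrt]
    have : 0 < Int.gcd h (Int.gcd x p) := by
      apply Int.gcd_pos_of_ne_zero_right
      have : 0 < Int.gcd x p := Int.gcd_pos_of_ne_zero_right _ (by exact_mod_cast hp.ne_zero)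
      exact_mod_cast this.ne'
    exact_mod_cast this
  · push Not at hhx
    have e1 : Int.gcd x p = p := by
      exact_mod_cast Int.gcd_eq_right (by positivity) hhx.2
    have e2 : Int.gcd h p = p := by
      exact_mod_cast Int.gcd_eq_right (by positivity) hhx.1
    rw [e1, e2, mul_assoc, Real.mul_self_sqrt (by positivity)]
    have h1 : ‖Wsum χ h x‖ ≤ p := by
      rw [WB.Wsum_eq]
      refine (norm_sum_le _ _).trans ?_
      calc _ ≤ ∑ n : ZMod p, (1 : ℝ) := by
            apply Finset.sum_le_sum
            intro n _
            rw [norm_mul, AddChar.norm_apply, mul_one]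
            exact WB.norm_chi_conj_le χ _ _
        _ = p := by simp [ZMod.card]
    have : (0 : ℝ) ≤ p := by positivity
    linarith
end

section
/- Let $q$ be a squarefree positive integer and $\chi$ a primitive Dirichlet character modulo $q$. Then for any integers $h, x$ and any $\epsilon > 0$, $\left| \sum_{n \bmod q} \chi(n) \overline{\chi(n+h)} e^{2\pi i n x/q} \right| \ll_\epsilon q^{1/2 + \epsilon} \gcd(h, x, q)^{1/2}$. -/
open Finset Complex

namespace WeilAux
open Polynomial

theorem hasse_dvd {K : Type*} [Field K] (f k : K[X]) (a l : ℕ) :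
    f ^ (a - l) ∣ hasseDeriv l (f ^ a * k) := by
  induction a generalizing l with
  | zero => simp
  | succ a ih =>
    rw [pow_succ', mul_assoc, hasseDeriv_mul]
    refine Finset.dvd_sum fun ij hij => ?_
    rw [Finset.HasAntidiagonal.mem_antidiagonal] at hij
    rcases Nat.eq_zero_or_pos ij.1 with h0 | h0
    · have h2 : ij.2 = l := by omega
      rw [h0, h2, hasseDeriv_zero']
      refine (pow_dvd_pow f (show a + 1 - l ≤ (a - l) + 1 by omega)).trans ?_
      rw [pow_succ']
      exact mul_dvd_mul_left _ (ih l)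
    · refine Dvd.dvd.mul_left ?_ _
      exact (pow_dvd_pow f (by omega)).trans (ih ij.2)

theorem exists_E {K : Type*} [Field K] (f : K[X]) (hf : f ≠ 0) (a l : ℕ) :
    ∃ E : K[X] →ₗ[K] K[X], ∀ k, f ^ (a - l) * E k = hasseDeriv l (f ^ a * k) := by
  let μ : K[X] →ₗ[K] K[X] := LinearMap.mulLeft K (f ^ (a - l))
  have hμ : Function.Injective μ := fun x y h => mul_left_cancel₀ (pow_ne_zero _ hf) h
  let D : K[X] →ₗ[K] K[X] := (hasseDeriv l).comp (LinearMap.mulLeft K (f ^ a))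
  have hD : ∀ k, D k ∈ LinearMap.range μ := by
    intro k
    obtain ⟨c, hc⟩ := hasse_dvd f k a l
    exact ⟨c, hc.symm⟩
  refine ⟨(LinearEquiv.ofInjective μ hμ).symm.toLinearMap.comp (D.codRestrict _ hD), fun k => ?_⟩
  have := congrArg Subtype.val
    ((LinearEquiv.ofInjective μ hμ).apply_symm_apply (D.codRestrict _ hD k))
  exact this

theorem E_degree {K : Type*} [Field K] (f : K[X]) (hf : f ≠ 0) (a l : ℕ) (hl : l ≤ a) (e k : K[X])
    (h : f ^ (a - l) * e = hasseDeriv l (f ^ a * k)) :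
    e.natDegree ≤ k.natDegree + l * f.natDegree := by
  by_cases he : e = 0
  · simp [he]
  have h1 := congrArg natDegree h
  rw [natDegree_mul (pow_ne_zero _ hf) he, natDegree_pow] at h1
  have h2 := natDegree_hasseDeriv_le (f ^ a * k) l
  have h3 : (f ^ a * k).natDegree ≤ a * f.natDegree + k.natDegree := by
    refine natDegree_mul_le.trans ?_
    rw [natDegree_pow]
  obtain ⟨b, rfl⟩ := Nat.exists_eq_add_of_le hl
  have : l + b - l = b := by omega
  rw [this] at h1
  have : (l + b) * f.natDegree = l * f.natDegree + b * f.natDegree := by ring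
  omega

/-- linear independence by orders of vanishing at `0`. -/
theorem indep {K : Type*} [Field K] (N n : ℕ) (ex : ℕ → ℕ)
    (hex : ∀ a b, a < b → ex a + N ≤ ex b) (g k : ℕ → K[X]) (hg : ∀ a, (g a).coeff 0 ≠ 0)
    (hk : ∀ a, k a ∈ degreeLT K N)
    (h : ∑ a ∈ Finset.range n, X ^ ex a * g a * k a = 0) : ∀ a < n, k a = 0 := by
  intro a
  induction a using Nat.strong_induction_on with
  | _ a ih =>
    intro ha
    have h1 : X ^ (ex a + N) ∣ X ^ ex a * g a * k a := by
      rw [← Finset.add_sum_erase _ _ (Finset.mem_range.2 ha)] at h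
      rw [eq_neg_of_add_eq_zero_left h, dvd_neg]
      refine Finset.dvd_sum fun b hb => ?_
      rw [Finset.mem_erase, Finset.mem_range] at hb
      rcases lt_or_gt_of_ne hb.1 with hlt | hlt
      · rw [ih b hlt hb.2]; simp
      · rw [mul_assoc]
        exact (pow_dvd_pow X (hex _ _ hlt)).mul_right _
    rw [pow_add, mul_assoc] at h1
    have h2 := (mul_dvd_mul_iff_left (pow_ne_zero _ X_ne_zero)).1 h1
    have hc : IsCoprime (X ^ N : K[X]) (g a) := by
      refine IsCoprime.pow_left ?_
      refine (irreducible_X.coprime_iff_not_dvd).2 ?_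
      rw [X_dvd_iff]; exact hg a
    have h3 := hc.dvd_of_dvd_mul_left h2
    rw [X_pow_dvd_iff] at h3
    ext d
    rw [coeff_zero]
    by_cases hd : d < N
    · exact h3 d hd
    · have := mem_degreeLT.1 (hk a)
      exact coeff_eq_zero_of_degree_lt (this.trans_le (by exact_mod_cast not_lt.1 hd))

theorem finrank_degLT {K : Type*} [Field K] (n : ℕ) : Module.finrank K (degreeLT K n) = n := by
  rw [(degreeLTEquiv K n).finrank_eq]; simp

theorem mem_degLT_iff {K : Type*} [Field K] {n : ℕ} (hn : 0 < n) (f : K[X]) :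
    f ∈ degreeLT K n ↔ f.natDegree < n := by
  rw [mem_degreeLT]
  constructor
  · intro h
    by_cases hf : f = 0
    · simpa [hf]
    · exact (natDegree_lt_iff_degree_lt hf).2 h
  · intro h
    exact degree_le_natDegree.trans_lt (by exact_mod_cast h)

instance finDegLT {K : Type*} [Field K] (n : ℕ) : FiniteDimensional K (degreeLT K n) :=
  Module.Finite.equiv (degreeLTEquiv K n).symm

theorem pow_sub_dvd_of_taylor {K : Type*} [Field K] (P : K[X]) (z : K) (M : ℕ)
    (h : ∀ l < M, (taylor z P).coeff l = 0) : (X - C z) ^ M ∣ P := by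
  have h1 := X_pow_dvd_iff.2 h
  obtain ⟨c, hc⟩ := h1
  refine ⟨taylor (-z) c, ?_⟩
  have := congrArg (taylor (-z)) hc
  rw [taylor_taylor, taylor_mul, taylor_pow] at this
  simpa [sub_eq_add_neg] using this

theorem taylor_coeff_frob {K : Type*} [Field K] (p n j l : ℕ) [Fact p.Prime] [CharP K p] (g : K[X]) (z : K)
    (hl : l < p ^ n) :
    (taylor z (X ^ (p ^ n * j) * g)).coeff l = (z ^ p ^ n) ^ j * (hasseDeriv l g).eval z := by
  rw [taylor_mul, taylor_pow, taylor_X, pow_mul, add_pow_char_pow, ← taylor_coeff]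
  have h : ((X : K[X]) ^ p ^ n) ∣ (X ^ p ^ n + C z ^ p ^ n) ^ j - (C z ^ p ^ n) ^ j := by
    refine dvd_trans ?_ (sub_dvd_pow_sub_pow _ _ j)
    simp
  obtain ⟨c, hc⟩ := h
  rw [sub_eq_iff_eq_add] at hc
  rw [hc, add_mul, coeff_add, mul_assoc, X_pow_dvd_iff.1 (Dvd.intro _ rfl) l hl, zero_add,
    ← C_pow, ← C_pow, coeff_C_mul]

/-- The Stepanov method. -/
theorem stepanov {K : Type*} [Field K] (p s d t m : ℕ) [Fact p.Prime] [CharP K p]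
    (hd : 0 < d) (ht : 0 < t) (hdt : p ^ s = d * t + 1)
    (f : K[X]) (hm : f.natDegree = m) (hf0 : f.coeff 0 = 0) (hf1 : f.coeff 1 ≠ 0) (e u : K)
    (S : Finset K)
    (hS : ∀ z ∈ S, z ^ p ^ (2 * s) = z + e ∧ f.eval z ^ (t * (p ^ s + 1)) = u) :
    d * t * S.card ≤ (d * t + d * (t * (p ^ s + 1))) * m + t * (p ^ s + 1) + p ^ (2 * s) * (t + m) := by
  classical
  set Q := p ^ s with hQ
  set N := t * (Q + 1) with hN
  set M := d * t with hM
  set J := t + m + 1 with hJ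
  have hq : p ^ (2 * s) = d * N + 1 := by
    rw [mul_comm, pow_mul, ← hQ, hN, hdt]; ring
  have hNpos : 0 < N := by positivity
  have hf : f ≠ 0 := by rintro rfl; simp at hf1
  choose E hE using fun (i l : ℕ) => exists_E f hf (M + i * N) l
  let V := Fin (d * J) → degreeLT K N
  let T := N + M * m + J
  have hT : 0 < T := by positivity
  let Φ0 : Fin M → (V →ₗ[K] K[X]) := fun l =>
    ∑ a : Fin (d * J), (LinearMap.mulLeft K (C u ^ (a.1 % d) * (X + C e) ^ (a.1 / d))).comp
      ((E (a.1 % d) l).comp ((degreeLT K N).subtype.comp (LinearMap.proj a)))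
  have hΦ0 : ∀ l k, Φ0 l k = ∑ a : Fin (d * J), C u ^ (a.1 % d) * (X + C e) ^ (a.1 / d) *
      E (a.1 % d) l (k a : K[X]) := by
    intro l k
    simp only [Φ0, LinearMap.sum_apply]
    rfl
  have hdeg : ∀ l k, Φ0 l k ∈ degreeLT K T := by
    intro l k
    rw [hΦ0]
    refine Submodule.sum_mem _ fun a _ => ?_
    rw [mem_degLT_iff hT]
    have h1 := (mem_degLT_iff hNpos _).1 (k a).2
    have h2 := E_degree f hf (M + a.1 % d * N) l (by have := l.2; omega) _ _ (hE (a.1 % d) l (k a))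
    have h3 : a.1 / d < J := Nat.div_lt_of_lt_mul a.2
    have h4 : (C u ^ (a.1 % d) * (X + C e) ^ (a.1 / d)).natDegree ≤ a.1 / d := by
      rw [← C_pow]
      refine (natDegree_C_mul_le _ _).trans ?_
      refine natDegree_pow_le.trans ?_
      simp
    have h5 : (l : ℕ) * f.natDegree ≤ M * m := by rw [hm]; exact Nat.mul_le_mul_right _ l.2.le
    refine natDegree_mul_le.trans_lt ?_
    omega
  let Φ : V →ₗ[K] (Fin M → degreeLT K T) := LinearMap.pi fun l => (Φ0 l).codRestrict _ (hdeg l)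
  have hker : LinearMap.ker Φ ≠ ⊥ := by
    apply LinearMap.ker_ne_bot_of_finrank_lt
    rw [Module.finrank_pi_fintype, Module.finrank_pi_fintype]
    simp only [finrank_degLT, Finset.sum_const, Finset.card_univ, Fintype.card_fin, smul_eq_mul]
    show M * (N + M * m + J) < d * J * N
    have : N + M * m + J < J * (Q + 1) := by
      rw [hN, hdt, hM, hJ]; 
      have : t ≤ d * t := Nat.le_mul_of_pos_left _ hd
      nlinarith
    calc M * (N + M * m + J) < M * (J * (Q + 1)) := Nat.mul_lt_mul_of_pos_left this (by positivity)
      _ = d * J * N := by rw [hM, hN]; ring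
  obtain ⟨k, hk, hk0⟩ := (Submodule.ne_bot_iff _).1 hker
  have hk1 : ∀ l : Fin M, ∑ a : Fin (d * J), C u ^ (a.1 % d) * (X + C e) ^ (a.1 / d) *
      E (a.1 % d) l (k a : K[X]) = 0 := by
    intro l
    rw [← hΦ0]
    exact congrArg Subtype.val (congrFun (LinearMap.mem_ker.1 hk) l)
  let k' : ℕ → K[X] := fun a => if h : a < d * J then (k ⟨a, h⟩ : K[X]) else 0
  have hk' : ∀ a : Fin (d * J), k' a = k a := fun a => by simp [k', a.2]
  have hk'N : ∀ a, k' a ∈ degreeLT K N := by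
    intro a
    by_cases h : a < d * J
    · simp [k', h]
    · simp [k', h]
  let P : K[X] := ∑ a ∈ Finset.range (d * J), X ^ (p ^ (2 * s) * (a / d)) * (f ^ (M + a % d * N) * k' a)
  obtain ⟨g, hg⟩ : X ∣ f := X_dvd_iff.2 hf0
  have hg0 : g.coeff 0 ≠ 0 := by
    rw [hg] at hf1; simpa using hf1
  have hP : P ≠ 0 := by
    intro h0
    apply hk0
    have key := indep N (d * J) (fun a => p ^ (2 * s) * (a / d) + (M + a % d * N)) ?_
      (fun a => g ^ (M + a % d * N)) k' ?_ hk'N ?_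
    · ext1 a
      apply Subtype.ext
      rw [← hk' a, key a a.2]; rfl
    · intro a b hab
      have hb := Nat.div_add_mod b d
      have ha := Nat.div_add_mod a d
      have hma := Nat.mod_lt a hd
      rw [hq]
      have : a / d ≤ b / d := Nat.div_le_div_right hab.le
      rcases this.eq_or_lt with h | h
      · have : a % d + 1 ≤ b % d := by rw [h] at ha; omega
        have := Nat.mul_le_mul_right N this
        simp only [h]
        nlinarith
      · have h1 := Nat.mul_le_mul_left (d * N + 1) (Nat.succ_le_of_lt h)
        have h2 := Nat.mul_le_mul_right N (Nat.succ_le_of_lt hma)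
        simp only [Nat.succ_eq_add_one] at h1 h2
        nlinarith
    · intro a
      rw [coeff_zero_eq_eval_zero, eval_pow, ← coeff_zero_eq_eval_zero]
      exact pow_ne_zero _ hg0
    · rw [← h0]
      refine Finset.sum_congr rfl fun a _ => ?_
      simp only [hg, pow_add, mul_pow]
      ring
  have hdvd : ∀ z ∈ S, (X - C z) ^ M ∣ P := by
    intro z hz
    obtain ⟨hz1, hz2⟩ := hS z hz
    apply pow_sub_dvd_of_taylor
    intro l hl
    have hlq : l < p ^ (2 * s) := by
      rw [hq]
      have : d * t ≤ d * N := Nat.mul_le_mul_left _ (by rw [hN]; exact Nat.le_mul_of_pos_right _ (by positivity))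
      omega
    rw [map_sum, finsetSum_coeff]
    have h1 := congrArg (eval z) (hk1 ⟨l, hl⟩)
    rw [eval_finsetSum, eval_zero] at h1
    have h2 : ∑ a ∈ Finset.range (d * J), (u ^ (a % d) * (z + e) ^ (a / d)) * (E (a % d) l (k' a)).eval z = 0 := by
      rw [← h1, Finset.sum_range]
      refine Finset.sum_congr rfl fun a _ => ?_
      simp [hk']
    rw [← mul_zero (f.eval z ^ (M - l)), ← h2, Finset.mul_sum]
    refine Finset.sum_congr rfl fun a _ => ?_
    rw [taylor_coeff_frob p _ _ _ _ _ hlq, hz1, ← hE (a % d) l (k' a), eval_mul, eval_pow, ← hz2,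
      show M + a % d * N - l = (M - l) + N * (a % d) by rw [mul_comm N]; omega, pow_add, pow_mul]
    ring
  have hprod : (∏ z ∈ S, (X - C z) ^ M) ∣ P := by
    apply Finset.prod_dvd_of_coprime _ hdvd
    intro a _ b _ hab
    exact (isCoprime_X_sub_C_of_isUnit_sub (sub_ne_zero.2 hab).isUnit).pow
  have h1 := natDegree_le_of_dvd hprod hP
  have h2 : (∏ z ∈ S, (X - C z) ^ M).natDegree = M * S.card := by
    rw [natDegree_prod_of_monic _ _ fun z _ => (monic_X_sub_C z).pow M]
    simp [natDegree_pow, mul_comm]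
  rw [h2] at h1
  refine h1.trans ?_
  refine natDegree_sum_le_of_forall_le _ _ fun a ha => ?_
  rw [Finset.mem_range] at ha
  have h3 : a / d ≤ t + m := Nat.lt_succ_iff.1 (Nat.div_lt_of_lt_mul ha)
  have h4 := Nat.mul_le_mul_left (p ^ (2 * s)) h3
  have h5 := (mem_degLT_iff hNpos _).1 (hk'N a)
  have h6 : (M + a % d * N) * m ≤ (M + d * N) * m :=
    Nat.mul_le_mul_right _ (Nat.add_le_add_left (Nat.mul_le_mul_right _ (Nat.mod_lt a hd).le) _)
  refine natDegree_mul_le.trans ?_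
  rw [natDegree_X_pow]
  have h7 : (f ^ (M + a % d * N) * k' a).natDegree ≤ (M + a % d * N) * m + (k' a).natDegree := by
    refine natDegree_mul_le.trans ?_
    rw [natDegree_pow, hm]
  omega

end WeilAux

namespace WeilAux
set_option linter.unusedSectionVars false
open Polynomial

noncomputable def conjProd {K : Type*} [Field K] (p r : ℕ) (ρ : K) : K[X] :=
  ∏ i ∈ Finset.range r, (X - C (ρ ^ p ^ i))

section
variable {K : Type*} [Field K] (p : ℕ) [Fact p.Prime] [Algebra (ZMod p) K] [CharP K p]

theorem conjProd_monic (r : ℕ) (ρ : K) : (conjProd p r ρ).Monic :=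
  monic_prod_of_monic _ _ fun _ _ => monic_X_sub_C _

theorem mem_range_of_pow (x : K) (hx : x ^ p = x) : ∃ y : ZMod p, algebraMap (ZMod p) K y = x := by
  have := (Subfield.mem_bot_iff_pow_eq_self (F := K) (p := p)).2 hx
  rw [← ZMod.fieldRange_castHom_eq_bot p] at this
  obtain ⟨y, hy⟩ := this
  exact ⟨y, by rw [← hy]; congr 1; exact Subsingleton.elim _ _⟩

theorem conjProd_lift (r : ℕ) (ρ : K) (hρ : ρ ^ p ^ r = ρ) :
    ∃ Q : (ZMod p)[X], Q.map (algebraMap (ZMod p) K) = conjProd p r ρ := by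
  have hmap : (conjProd p r ρ).map (frobenius K p) = conjProd p r ρ := by
    have h1 : (conjProd p r ρ).map (frobenius K p) = ∏ i ∈ Finset.range r, (X - C (ρ ^ p ^ (i + 1))) := by
      simp only [conjProd, Polynomial.map_prod, Polynomial.map_sub, map_X, map_C, frobenius_def, ← pow_mul, pow_succ]
    have h2 : (∏ i ∈ Finset.range r, (X - C (ρ ^ p ^ (i + 1)))) * (X - C ρ) =
        (conjProd p r ρ) * (X - C ρ) := by
      have a1 := Finset.prod_range_succ (fun i => (X - C (ρ ^ p ^ i) : K[X])) r
      have a2 := Finset.prod_range_succ' (fun i => (X - C (ρ ^ p ^ i) : K[X])) r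
      simp only [pow_zero, pow_one] at a2
      rw [← a2, a1, hρ]; rfl
    rw [h1]
    exact mul_right_cancel₀ (X_sub_C_ne_zero ρ) h2
  have hl : conjProd p r ρ ∈ lifts (algebraMap (ZMod p) K) := by
    rw [lifts_iff_coeff_lifts]
    intro n
    apply mem_range_of_pow
    have := congrArg (fun P => P.coeff n) hmap
    simpa [coeff_map, frobenius_def] using this
  obtain ⟨Q, hQ⟩ := hl
  exact ⟨Q, hQ⟩

theorem aeval_frob (P : (ZMod p)[X]) (ρ : K) (h : aeval ρ P = 0) (i : ℕ) : aeval (ρ ^ p ^ i) P = 0 := by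
  induction i with
  | zero => simpa
  | succ i ih =>
    rw [pow_succ, pow_mul, ← expand_aeval, ZMod.expand_card, map_pow, ih,
      zero_pow (Fact.out : p.Prime).ne_zero]

variable [IsAlgClosed K] 

theorem eq_pow_of_roots (ρ : K) (hρ : IsIntegral (ZMod p) ρ) (n : ℕ) (Q : (ZMod p)[X]) (hQ : Q.Monic) (hn : Q.natDegree = n)
    (h : ∀ σ : K, aeval σ Q = 0 → aeval σ (minpoly (ZMod p) ρ) = 0) :
    ∃ k, Q = minpoly (ZMod p) ρ ^ k := by
  induction n using Nat.strong_induction_on generalizing Q with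
  | _ n ih =>
    rcases Nat.eq_zero_or_pos n with h0 | h0
    · exact ⟨0, by rw [pow_zero]; exact hQ.natDegree_eq_zero.1 (hn.trans h0)⟩
    obtain ⟨σ, hσ⟩ := IsAlgClosed.exists_aeval_eq_zero K Q (by
      intro hd
      have h9 : Q.natDegree = 0 := natDegree_eq_of_degree_eq_some hd
      omega)
    have h1 := h σ hσ
    have h2 := minpoly.eq_of_irreducible_of_monic (minpoly.irreducible hρ) h1 (minpoly.monic hρ)
    obtain ⟨Q', hQ'⟩ := minpoly.dvd _ _ hσ
    rw [← h2] at hQ'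
    have hm' : Q'.Monic := (minpoly.monic hρ).of_mul_monic_left (hQ' ▸ hQ)
    have hdeg : Q.natDegree = (minpoly (ZMod p) ρ).natDegree + Q'.natDegree := by
      rw [hQ', (minpoly.monic hρ).natDegree_mul hm']
    obtain ⟨k, hk⟩ := ih Q'.natDegree (by have := minpoly.natDegree_pos hρ; omega) Q' hm' rfl (by
      intro τ hτ; apply h; rw [hQ', map_mul, hτ, mul_zero])
    exact ⟨k + 1, by rw [hQ', hk, pow_succ']⟩


noncomputable def Qpol (r : ℕ) (ρ : K) : (ZMod p)[X] :=
  minpoly (ZMod p) ρ ^ (r / (minpoly (ZMod p) ρ).natDegree)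

theorem Qpol_spec (r : ℕ) (ρ : K) (hi : IsIntegral (ZMod p) ρ) (hρ : ρ ^ p ^ r = ρ) :
    (Qpol p r ρ).map (algebraMap (ZMod p) K) = conjProd p r ρ ∧ (minpoly (ZMod p) ρ).natDegree ∣ r := by
  obtain ⟨Q, hQ⟩ := conjProd_lift p r ρ hρ
  have hQm : Q.Monic := by
    have := conjProd_monic p r ρ
    rw [← hQ] at this
    exact monic_of_injective (algebraMap (ZMod p) K).injective this
  have hdeg : Q.natDegree = r := by
    rw [← natDegree_map (algebraMap (ZMod p) K), hQ, conjProd,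
      natDegree_prod_of_monic _ _ fun _ _ => monic_X_sub_C _]
    simp only [natDegree_X_sub_C, Finset.sum_const, Finset.card_range, smul_eq_mul, mul_one]
  obtain ⟨k, hk⟩ := eq_pow_of_roots p ρ hi _ Q hQm rfl (by
    intro σ hσ
    rw [aeval_def, ← eval_map, hQ, conjProd, eval_prod, Finset.prod_eq_zero_iff] at hσ
    obtain ⟨i, _, hi⟩ := hσ
    rw [eval_sub, eval_X, eval_C, sub_eq_zero] at hi
    rw [hi]
    exact aeval_frob p _ _ (minpoly.aeval _ _) i)
  have hr : r = k * (minpoly (ZMod p) ρ).natDegree := by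
    rw [← hdeg, hk, natDegree_pow]
  have hpos := minpoly.natDegree_pos hi
  refine ⟨?_, Dvd.intro_left _ hr.symm⟩
  rw [← hQ, Qpol, hk]
  conv_lhs => rw [hr, Nat.mul_div_cancel _ hpos]

theorem fix_of_dvd (r : ℕ) (ρ : K) (hi : IsIntegral (ZMod p) ρ) (h : (minpoly (ZMod p) ρ).natDegree ∣ r) :
    ρ ^ p ^ r = ρ := by
  have := (Irreducible.natDegree_dvd_iff_dvd_X_pow_card_pow_sub_X (k := ZMod p) (minpoly.irreducible hi)).1 h
  rw [minpoly.dvd_iff] at this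
  simpa [sub_eq_zero] using this

theorem rootMult (ρ : K) (hi : IsIntegral (ZMod p) ρ) (F : (ZMod p)[X]) (hF : F ≠ 0) (k : ℕ) :
    minpoly (ZMod p) ρ ^ k ∣ F ↔ k ≤ rootMultiplicity ρ (F.map (algebraMap (ZMod p) K)) := by
  classical
  have hinj := (algebraMap (ZMod p) K).injective
  set P := minpoly (ZMod p) ρ with hP
  have hPirr : Irreducible P := minpoly.irreducible hi
  have hfin : FiniteMultiplicity P F := FiniteMultiplicity.of_not_isUnit hPirr.not_isUnit hF
  obtain ⟨G, hG, hGd⟩ := hfin.exists_eq_pow_mul_and_not_dvd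
  have hG0 : G ≠ 0 := by rintro rfl; simp at hGd
  set m := multiplicity P F
  have hroot : rootMultiplicity ρ (P.map (algebraMap (ZMod p) K)) = 1 := by
    have hsep : (P.map (algebraMap (ZMod p) K)).Separable := 
      (PerfectField.separable_of_irreducible hPirr).map
    refine le_antisymm (rootMultiplicity_le_one_of_separable hsep ρ) ?_
    rw [Nat.one_le_iff_ne_zero, ← Nat.pos_iff_ne_zero, rootMultiplicity_pos ((Polynomial.map_ne_zero_iff hinj).2 hPirr.ne_zero)]
    rw [IsRoot, eval_map, ← aeval_def]; exact minpoly.aeval _ _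
  have hGr : rootMultiplicity ρ (G.map (algebraMap (ZMod p) K)) = 0 := by
    rw [rootMultiplicity_eq_zero_iff]
    intro h
    exfalso; apply hGd
    rw [IsRoot, eval_map, ← aeval_def] at h
    exact minpoly.dvd _ _ h
  have hmm : rootMultiplicity ρ (F.map (algebraMap (ZMod p) K)) = m := by
    rw [hG, Polynomial.map_mul, Polynomial.map_pow, rootMultiplicity_mul, hGr, ← count_roots,
      roots_pow, Multiset.count_nsmul, count_roots, hroot]
    · simp
    · exact mul_ne_zero (pow_ne_zero _ ((Polynomial.map_ne_zero_iff hinj).2 hPirr.ne_zero)) ((Polynomial.map_ne_zero_iff hinj).2 hG0)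
  rw [hmm]
  exact hfin.pow_dvd_iff_le_multiplicity

theorem count_r (ρ : K) (hi : IsIntegral (ZMod p) ρ) (F : (ZMod p)[X]) (hF : F ≠ 0) [DecidableEq K]
    [DecidablePred fun r => Qpol p r ρ ∣ F] :
    ((Finset.Icc 1 F.natDegree).filter (fun r => ρ ^ p ^ r = ρ ∧ Qpol p r ρ ∣ F)).card =
      rootMultiplicity ρ (F.map (algebraMap (ZMod p) K)) := by
  set m := rootMultiplicity ρ (F.map (algebraMap (ZMod p) K)) with hm
  set d := (minpoly (ZMod p) ρ).natDegree with hd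
  have hpos : 0 < d := minpoly.natDegree_pos hi
  have : ((Finset.Icc 1 F.natDegree).filter (fun r => ρ ^ p ^ r = ρ ∧ Qpol p r ρ ∣ F)) =
      (Finset.Icc 1 m).image (fun k => k * d) := by
    ext r
    simp only [Finset.mem_filter, Finset.mem_Icc, Finset.mem_image]
    constructor
    · rintro ⟨⟨h1, h2⟩, h3, h4⟩
      obtain ⟨k, hk⟩ := (Qpol_spec p r ρ hi h3).2
      rw [← hd] at hk
      rw [Qpol, rootMult p ρ hi F hF, ← hd, hk, Nat.mul_div_cancel_left _ hpos] at h4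
      refine ⟨k, ⟨?_, h4⟩, by rw [hk, mul_comm]⟩
      rcases Nat.eq_zero_or_pos k with h0 | h0
      · subst h0; omega
      · exact h0
    · rintro ⟨k, ⟨h1, h2⟩, rfl⟩
      have h5 := (rootMult p ρ hi F hF k).2 h2
      have h6 := natDegree_le_of_dvd h5 hF
      rw [natDegree_pow, ← hd] at h6
      refine ⟨⟨Nat.mul_pos h1 hpos, h6⟩, fix_of_dvd p _ ρ hi (Dvd.intro_left _ rfl), ?_⟩
      rw [Qpol, ← hd, Nat.mul_div_cancel _ hpos]
      exact h5
  rw [this, Finset.card_image_of_injective _ (fun x y hxy => Nat.eq_of_mul_eq_mul_right hpos hxy), Nat.card_Icc]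
  simp

open Classical in
noncomputable def Fix (r : ℕ) : Finset K := ((X ^ p ^ r - X : K[X]).roots).toFinset

theorem mem_Fix (r : ℕ) (hr : 0 < r) (ρ : K) : ρ ∈ Fix p r ↔ ρ ^ p ^ r = ρ := by
  classical
  rw [Fix, Multiset.mem_toFinset, mem_roots (FiniteField.X_pow_card_pow_sub_X_ne_zero K hr.ne' (Fact.out : p.Prime).one_lt)]
  simp [sub_eq_zero]

variable [Algebra.IsAlgebraic (ZMod p) K]

open Classical in
theorem degree_count (F : (ZMod p)[X]) (hF : F ≠ 0) :
    F.natDegree = ∑ r ∈ Finset.Icc 1 F.natDegree, ∑ ρ ∈ (Fix p r : Finset K),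
      if Qpol p r ρ ∣ F then 1 else 0 := by
  have hintg : ∀ ρ : K, IsIntegral (ZMod p) ρ := fun ρ => Algebra.IsIntegral.isIntegral ρ
  set FK := F.map (algebraMap (ZMod p) K) with hFK
  have hFK0 : FK ≠ 0 := (Polynomial.map_ne_zero_iff (algebraMap (ZMod p) K).injective).2 hF
  set U : Finset K := (Finset.Icc 1 F.natDegree).biUnion (fun r => Fix p r) ∪ FK.roots.toFinset with hU
  have h1 : ∀ r ∈ Finset.Icc 1 F.natDegree, (∑ ρ ∈ (Fix p r : Finset K),
      if Qpol p r ρ ∣ F then 1 else 0) = ∑ ρ ∈ U, if (ρ ^ p ^ r = ρ ∧ Qpol p r ρ ∣ F) then 1 else 0 := by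
    intro r hr
    have hr1 : 0 < r := (Finset.mem_Icc.1 hr).1
    have hsub : (Fix p r : Finset K) = U.filter (fun ρ => ρ ^ p ^ r = ρ) := by
      ext ρ
      rw [Finset.mem_filter, mem_Fix p r hr1]
      constructor
      · intro h
        refine ⟨?_, h⟩
        rw [hU, Finset.mem_union, Finset.mem_biUnion]
        exact Or.inl ⟨r, hr, (mem_Fix p r hr1 ρ).2 h⟩
      · exact fun h => h.2
    rw [hsub, Finset.sum_filter]
    refine Finset.sum_congr rfl fun ρ _ => ?_
    by_cases h : ρ ^ p ^ r = ρ <;> simp [h]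
  rw [Finset.sum_congr rfl h1, Finset.sum_comm]
  have h2 : ∀ ρ ∈ U, (∑ r ∈ Finset.Icc 1 F.natDegree, if (ρ ^ p ^ r = ρ ∧ Qpol p r ρ ∣ F) then 1 else 0)
      = FK.roots.count ρ := by
    intro ρ _
    rw [← Finset.card_filter, count_r p ρ (hintg ρ) F hF, count_roots]
  rw [Finset.sum_congr rfl h2, Multiset.sum_count_eq_card, ← natDegree_map (algebraMap (ZMod p) K)]
  · exact (IsAlgClosed.splits FK).natDegree_eq_card_roots
  · intro a ha
    rw [hU, Finset.mem_union, Multiset.mem_toFinset]; exact Or.inr ha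

end

section
variable (p : ℕ) [Fact p.Prime]

theorem monics_finite (n : ℕ) : {F : (ZMod p)[X] | F.Monic ∧ F.natDegree = n}.Finite := by
  apply Set.Finite.of_injOn (f := fun F => fun i : Fin n => F.coeff i) (t := Set.univ) 
    (fun _ _ => Set.mem_univ _) _ Set.finite_univ
  rintro F ⟨hF, hFn⟩ G ⟨hG, hGn⟩ h
  ext i
  rcases lt_trichotomy i n with h1 | h1 | h1
  · exact congrFun h ⟨i, h1⟩
  · rw [h1]; nth_rewrite 1 [← hFn]; rw [← hGn, coeff_natDegree, coeff_natDegree, hF, hG]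
  · rw [coeff_eq_zero_of_natDegree_lt (by omega), coeff_eq_zero_of_natDegree_lt (by omega)]

noncomputable def Mon (n : ℕ) : Finset (ZMod p)[X] := (monics_finite p n).toFinset

theorem mem_Mon (n : ℕ) (F : (ZMod p)[X]) : F ∈ Mon p n ↔ F.Monic ∧ F.natDegree = n := by
  simp [Mon]

variable (Lam : (ZMod p)[X] → ℂ)

noncomputable def Ssum (n : ℕ) : ℂ := ∑ F ∈ Mon p n, Lam F

open Classical in
theorem sum_dvd (hLam : ∀ F G : (ZMod p)[X], F.Monic → G.Monic → Lam (F * G) = Lam F * Lam G)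
    (n r : ℕ) (hr : r ≤ n) (Q : (ZMod p)[X]) (hQ : Q.Monic) (hQr : Q.natDegree = r) :
    (∑ F ∈ Mon p n, if Q ∣ F then Lam F else 0) = Lam Q * Ssum p Lam (n - r) := by
  rw [← Finset.sum_filter, Ssum, Finset.mul_sum]
  symm
  refine Finset.sum_bij (fun G _ => Q * G) ?_ ?_ ?_ ?_
  · intro G hG
    rw [mem_Mon] at hG
    rw [Finset.mem_filter, mem_Mon]
    refine ⟨⟨hQ.mul hG.1, ?_⟩, Dvd.intro _ rfl⟩
    rw [hQ.natDegree_mul hG.1]; omega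
  · intro G _ G' _ h
    exact mul_left_cancel₀ hQ.ne_zero h
  · intro F hF
    rw [Finset.mem_filter, mem_Mon] at hF
    obtain ⟨⟨h1, h2⟩, G, rfl⟩ := hF
    have hG := hQ.of_mul_monic_left h1
    rw [hQ.natDegree_mul hG] at h2
    exact ⟨G, by rw [mem_Mon]; exact ⟨hG, by omega⟩, rfl⟩
  · intro G hG
    rw [mem_Mon] at hG
    rw [hLam _ _ hQ hG.1]

theorem Qpol_monic {K : Type*} [Field K] [Algebra (ZMod p) K] [Algebra.IsAlgebraic (ZMod p) K] (r : ℕ) (ρ : K) :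
    (Qpol p r ρ).Monic :=
  (minpoly.monic (Algebra.IsIntegral.isIntegral ρ)).pow _

theorem newton {K : Type*} [Field K] [Algebra (ZMod p) K] [CharP K p] [IsAlgClosed K]
    (hLam : ∀ F G : (ZMod p)[X], F.Monic → G.Monic → Lam (F * G) = Lam F * Lam G)
    [Algebra.IsAlgebraic (ZMod p) K] (n : ℕ) :
    n * Ssum p Lam n = ∑ r ∈ Finset.Icc 1 n, (∑ ρ ∈ (Fix p r : Finset K), Lam (Qpol p r ρ)) *
      Ssum p Lam (n - r) := by
  classical
  have h1 : n * Ssum p Lam n = ∑ F ∈ Mon p n, ∑ r ∈ Finset.Icc 1 n, ∑ ρ ∈ (Fix p r : Finset K),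
      if Qpol p r ρ ∣ F then Lam F else 0 := by
    rw [Ssum, Finset.mul_sum]
    refine Finset.sum_congr rfl fun F hF => ?_
    rw [mem_Mon] at hF
    have h2 := degree_count (K := K) p F hF.1.ne_zero
    rw [hF.2] at h2
    conv_lhs => rw [h2]
    push_cast
    simp only [Finset.sum_mul]
    refine Finset.sum_congr rfl fun r _ => Finset.sum_congr rfl fun ρ _ => ?_
    split_ifs <;> simp
  rw [h1, Finset.sum_comm]
  refine Finset.sum_congr rfl fun r hr => ?_
  rw [Finset.sum_comm, Finset.sum_mul]
  rw [Finset.mem_Icc] at hr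
  refine Finset.sum_congr rfl fun ρ hρ => ?_
  rw [mem_Fix p r hr.1] at hρ
  apply sum_dvd p Lam hLam n r hr.2 _ (Qpol_monic p r ρ)
  have hi : IsIntegral (ZMod p) ρ := Algebra.IsIntegral.isIntegral ρ
  rw [Qpol, natDegree_pow, Nat.div_mul_cancel (Qpol_spec p r ρ hi hρ).2]

end
end WeilAux

namespace WeilAux
set_option linter.unusedSectionVars false
open Polynomial

section
variable (p : ℕ) [Fact p.Prime] (χ : MulChar (ZMod p) ℂ) (ψ : AddChar (ZMod p) ℂ) (c : ZMod p)

noncomputable def Lam (F : (ZMod p)[X]) : ℂ :=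
  χ (F.eval 0) * χ⁻¹ (F.eval (-c)) * ψ (-F.nextCoeff)

theorem Lam_mul (F G : (ZMod p)[X]) (hF : F.Monic) (hG : G.Monic) :
    Lam p χ ψ c (F * G) = Lam p χ ψ c F * Lam p χ ψ c G := by
  simp only [Lam, eval_mul, map_mul, hF.nextCoeff_mul hG, neg_add, AddChar.map_add_eq_mul]
  ring

theorem S_zero : Ssum p (Lam p χ ψ c) 0 = 1 := by
  have : Mon p 0 = {1} := by
    ext F
    rw [mem_Mon, Finset.mem_singleton]
    constructor
    · rintro ⟨h1, h2⟩; exact h1.natDegree_eq_zero.1 h2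
    · rintro rfl; simp
  simp [Ssum, this, Lam, nextCoeff]

theorem S_one : Ssum p (Lam p χ ψ c) 1 = ∑ a : ZMod p, χ a * χ⁻¹ (a + c) * ψ a := by
  classical
  have : Mon p 1 = Finset.univ.image (fun a : ZMod p => X - C a) := by
    ext F
    rw [mem_Mon, Finset.mem_image]
    constructor
    · rintro ⟨h1, h2⟩
      refine ⟨-F.coeff 0, Finset.mem_univ _, ?_⟩
      rw [h1.eq_X_add_C h2]; simp
    · rintro ⟨a, _, rfl⟩; exact ⟨monic_X_sub_C a, natDegree_X_sub_C a⟩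
  rw [Ssum, this, Finset.sum_image]
  · refine Finset.sum_congr rfl fun a _ => ?_
    have h1 : χ (-1) * χ⁻¹ (-1) = 1 := by
      rw [← MulChar.mul_apply, mul_inv_cancel, MulChar.one_apply (by simp)]
    rw [Lam, nextCoeff_X_sub_C]
    simp only [eval_sub, eval_X, eval_C, neg_neg]
    rw [show (0 - a) = (-1) * a by ring, show (-c - a) = (-1) * (a + c) by ring, map_mul, map_mul]
    linear_combination (χ a * χ⁻¹ (a + c) * ψ a) * h1
  · intro a _ b _ h
    simpa using h

theorem S_ge (hψ : ψ ≠ 1) (n : ℕ) (hn : 3 ≤ n) : Ssum p (Lam p χ ψ c) n = 0 := by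
  obtain ⟨b, hb⟩ : ∃ b, ψ b ≠ 1 := by
    by_contra! h
    exact hψ (by ext b; simp [h b])
  let R : (ZMod p)[X] := C (-b) * (X ^ (n - 2) * (X + C c))
  have hRm : (X ^ (n - 2) * (X + C c)).Monic := (monic_X_pow _).mul (monic_X_add_C c)
  have hRd : (X ^ (n - 2) * (X + C c)).natDegree = n - 1 := by
    rw [(monic_X_pow _).natDegree_mul (monic_X_add_C c), natDegree_X_pow, natDegree_X_add_C]; omega
  have hRlt : R.degree < (n : ℕ) := by
    refine degree_le_natDegree.trans_lt ?_
    have h8 : R.natDegree ≤ n - 1 := (natDegree_C_mul_le (-b) (X ^ (n - 2) * (X + C c))).trans_eq hRd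
    exact_mod_cast (by omega : R.natDegree < n)
  have hRc : R.coeff (n - 1) = -b := by
    simp only [R, coeff_C_mul]
    rw [← hRd, hRm.coeff_natDegree]; simp
  have hR0 : R.eval 0 = 0 := by
    have : n - 2 ≠ 0 := by omega
    simp [R, this]
  have hR1 : R.eval (-c) = 0 := by simp [R]
  have hmem : ∀ F ∈ Mon p n, ∀ R : (ZMod p)[X], R.degree < (n : ℕ) → F + R ∈ Mon p n := by
    intro F hF R hR
    rw [mem_Mon] at hF ⊢
    have hlt : R.degree < F.degree := by rw [degree_eq_natDegree hF.1.ne_zero, hF.2]; exact hR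
    exact ⟨hF.1.add_of_left hlt, by rw [natDegree_add_eq_left_of_degree_lt hlt, hF.2]⟩
  have h : Ssum p (Lam p χ ψ c) n = Ssum p (Lam p χ ψ c) n * ψ b := by
    conv_rhs => rw [Ssum, Finset.sum_mul]
    symm
    refine Finset.sum_bij (fun F _ => F + R) (fun F hF => hmem F hF R hRlt) ?_ ?_ ?_
    · intro F _ G _ h; exact add_right_cancel h
    · intro G hG
      exact ⟨G + -R, hmem G hG (-R) (by rwa [degree_neg]), by ring⟩
    · intro F hF
      have h2 := hmem F hF R hRlt
      rw [mem_Mon] at hF h2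
      rw [Lam, Lam, eval_add, eval_add, hR0, hR1, nextCoeff_of_natDegree_pos (by omega),
        nextCoeff_of_natDegree_pos (by omega), hF.2, h2.2, coeff_add, hRc, neg_add, neg_neg,
        AddChar.map_add_eq_mul]
      ring_nf
  have : Ssum p (Lam p χ ψ c) n * (ψ b - 1) = 0 := by linear_combination -h
  rcases mul_eq_zero.1 this with h | h
  · exact h
  · exact absurd (sub_eq_zero.1 h) hb

theorem power_sums (S W : ℕ → ℂ) (h0 : S 0 = 1) (h3 : ∀ n, 3 ≤ n → S n = 0)
    (hN : ∀ n : ℕ, n * S n = ∑ r ∈ Finset.Icc 1 n, W r * S (n - r)) :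
    ∃ α β : ℂ, S 1 = -(α + β) ∧ ∀ r, 1 ≤ r → W r = -(α ^ r + β ^ r) := by
  obtain ⟨α, hα⟩ : ∃ α : ℂ, α ^ 2 + S 1 * α + S 2 = 0 := by
    obtain ⟨α, hα⟩ := IsAlgClosed.exists_pow_nat_eq (S 1 ^ 2 / 4 - S 2) (n := 2) (by norm_num)
    exact ⟨α - S 1 / 2, by linear_combination hα⟩
  refine ⟨α, -S 1 - α, by ring, ?_⟩
  set β := -S 1 - α with hβ
  have e1 : S 1 = -(α + β) := by rw [hβ]; ring
  have e2 : S 2 = α * β := by rw [hβ]; linear_combination hα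
  have w1 : W 1 = S 1 := by
    have := hN 1; simp [h0] at this; exact this.symm
  have w2 : W 2 = 2 * S 2 - W 1 * S 1 := by
    have := hN 2
    rw [Finset.sum_Icc_succ_top (by norm_num)] at this
    simp [h0] at this
    linear_combination -this
  intro r
  induction r using Nat.strong_induction_on with
  | _ r ih =>
    intro hr
    rcases Nat.lt_or_ge r 3 with h | h
    · interval_cases r
      · rw [w1, e1]; ring
      · rw [w2, w1, e1, e2]; ring
    · obtain ⟨m, rfl⟩ := Nat.exists_eq_add_of_le' h
      have := hN (m + 3)
      rw [h3 _ h, mul_zero, Finset.sum_Icc_succ_top (by omega), Finset.sum_Icc_succ_top (by omega),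
        Finset.sum_Icc_succ_top (by omega), Finset.sum_eq_zero] at this
      · rw [show m + 2 + 1 - (m + 1) = 2 by omega, show m + 2 + 1 - (m + 1 + 1) = 1 by omega,
          show m + 2 + 1 - (m + 2 + 1) = 0 by omega, h0, ih (m + 1) (by omega) (by omega),
          ih (m + 1 + 1) (by omega) (by omega), e1, e2] at this
        linear_combination -this
      · intro i hi
        rw [Finset.mem_Icc] at hi
        rw [h3 _ (by omega), mul_zero]

theorem le_of_pow_le (x y C : ℝ) (hx : 0 ≤ x) (hy : 0 < y) (h : ∀ n : ℕ, 1 ≤ n → x ^ n ≤ C * y ^ n) : x ≤ y := by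
  by_contra! hlt
  have h1 : 1 < x / y := (one_lt_div hy).2 hlt
  obtain ⟨n, hn⟩ := pow_unbounded_of_one_lt C h1
  have h2 : C < (x / y) ^ (n + 1) := hn.trans (pow_lt_pow_right₀ h1 (Nat.lt_succ_self n))
  rw [div_pow, lt_div_iff₀ (by positivity)] at h2
  exact absurd (h (n + 1) (by omega)) (not_le.2 h2)


theorem eig_bound (a b : ℂ) (y C : ℝ) (hy : 0 < y)
    (h : ∀ s : ℕ, 1 ≤ s → ‖a ^ s + b ^ s‖ ≤ C * y ^ s) : ‖a‖ ≤ y := by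
  have hC : 0 ≤ C := by
    have := (norm_nonneg _).trans (h 1 le_rfl)
    rw [pow_one] at this
    exact nonneg_of_mul_nonneg_left this hy
  apply le_of_pow_le ‖a‖ y (C + Real.sqrt (3 * C ^ 2 + 2 * C) ) (norm_nonneg _) hy
  intro n hn
  have hyn : 0 < y ^ n := by positivity
  have h1 := h n hn
  have h2 := h (2 * n) (by omega)
  have e : (a ^ n - b ^ n) ^ 2 = 2 * (a ^ (2 * n) + b ^ (2 * n)) - (a ^ n + b ^ n) ^ 2 := by
    rw [pow_mul', pow_mul']; ring
  have h3 : ‖a ^ n - b ^ n‖ ^ 2 ≤ (3 * C ^ 2 + 2 * C) * (y ^ n) ^ 2 := by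
    rw [← norm_pow, e]
    refine (norm_sub_le _ _).trans ?_
    rw [norm_mul, norm_pow]
    have h4 : ‖a ^ n + b ^ n‖ ^ 2 ≤ (C * y ^ n) ^ 2 := pow_le_pow_left₀ (norm_nonneg _) h1 2
    rw [show y ^ (2 * n) = (y ^ n) ^ 2 from pow_mul' y 2 n] at h2
    simp only [Complex.norm_ofNat]
    nlinarith [mul_nonneg (sq_nonneg C) (sq_nonneg (y ^ n))]
  have h5 : ‖a ^ n - b ^ n‖ ≤ Real.sqrt (3 * C ^ 2 + 2 * C) * y ^ n := by
    have := Real.sqrt_le_sqrt h3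
    rwa [Real.sqrt_sq (norm_nonneg _), Real.sqrt_mul (by positivity), Real.sqrt_sq hyn.le] at this
  have h6 : (2 : ℂ) * a ^ n = (a ^ n + b ^ n) + (a ^ n - b ^ n) := by ring
  have h7 : 2 * ‖a‖ ^ n ≤ ‖a ^ n + b ^ n‖ + ‖a ^ n - b ^ n‖ := by
    rw [← norm_pow]
    calc 2 * ‖a ^ n‖ = ‖(2 : ℂ) * a ^ n‖ := by simp
      _ ≤ _ := by rw [h6]; exact norm_add_le _ _
  have : 0 ≤ ‖a‖ ^ n := by positivity
  rw [add_mul]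
  linarith

end

section
variable {K : Type*} [Field K] (p : ℕ) [Fact p.Prime] [Algebra (ZMod p) K] [CharP K p]
  [IsAlgClosed K] [Algebra.IsAlgebraic (ZMod p) K]

theorem Qpol_eval (r : ℕ) (x : K) (hx : x ^ p ^ r = x) (a : ZMod p) :
    algebraMap (ZMod p) K ((Qpol p r x).eval a) =
      (algebraMap (ZMod p) K a - x) ^ (∑ i ∈ Finset.range r, p ^ i) := by
  have h := (Qpol_spec p r x (Algebra.IsIntegral.isIntegral x) hx).1
  rw [← eval₂_at_apply, ← eval_map, h, conjProd, eval_prod, ← Finset.prod_pow_eq_pow_sum]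
  refine Finset.prod_congr rfl fun i _ => ?_
  rw [eval_sub, eval_X, eval_C, sub_pow_char_pow, ← map_pow, ZMod.pow_card_pow]

theorem Qpol_next (r : ℕ) (x : K) (hx : x ^ p ^ r = x) :
    algebraMap (ZMod p) K (-(Qpol p r x).nextCoeff) = ∑ i ∈ Finset.range r, x ^ p ^ i := by
  have h := (Qpol_spec p r x (Algebra.IsIntegral.isIntegral x) hx).1
  rw [map_neg, ← nextCoeff_map (algebraMap (ZMod p) K).injective, h, conjProd, prod_X_sub_C_nextCoeff,
    neg_neg]

theorem trace_tel (r : ℕ) (z : K) : z ^ p ^ r = z + ∑ i ∈ Finset.range r, (z ^ p - z) ^ p ^ i := by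
  have : ∀ i ∈ Finset.range r, (z ^ p - z) ^ p ^ i = z ^ p ^ (i + 1) - z ^ p ^ i := by
    intro i _
    rw [sub_pow_char_pow, ← pow_mul, pow_succ']
  rw [Finset.sum_congr rfl this, Finset.sum_range_sub (fun i => z ^ p ^ i)]
  simp

theorem card_Fix (r : ℕ) (hr : 0 < r) : (Fix p r : Finset K).card = p ^ r := by
  classical
  have hsep : (X ^ p ^ r - X : K[X]).Separable := galois_poly_separable p _ (dvd_pow_self p hr.ne')
  rw [Fix, Multiset.toFinset_card_of_nodup (nodup_roots hsep),
    ← (IsAlgClosed.splits _).natDegree_eq_card_roots,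
    FiniteField.X_pow_card_pow_sub_X_natDegree_eq K hr.ne' (Fact.out : p.Prime).one_lt]

theorem card_AS [DecidableEq K] (x : K) : ((X ^ p - X - C x : K[X]).roots.toFinset).card = p ∧
    ∀ z, z ∈ (X ^ p - X - C x : K[X]).roots.toFinset → z ^ p - z = x := by
  have h1 : (X ^ p - X - C x : K[X]).natDegree = p := by
    rw [natDegree_sub_C, FiniteField.X_pow_card_sub_X_natDegree_eq K (Fact.out : p.Prime).one_lt]
  have hsep : (X ^ p - X - C x : K[X]).Separable := by
    have : derivative (X ^ p - X - C x : K[X]) = -1 := by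
      simp [derivative_X_pow]
    rw [separable_def, this]
    exact isCoprime_one_right.neg_right
  refine ⟨?_, ?_⟩
  · rw [Multiset.toFinset_card_of_nodup (nodup_roots hsep),
      ← (IsAlgClosed.splits _).natDegree_eq_card_roots, h1]
  · intro z hz
    have := (mem_roots'.1 (Multiset.mem_toFinset.1 hz)).2
    simpa [IsRoot, sub_eq_zero] using this

end

end WeilAux

namespace WeilAux
set_option linter.unusedSectionVars false
open Polynomial

section
variable {K : Type*} [Field K] (p : ℕ) [Fact p.Prime] [Algebra (ZMod p) K] [CharP K p]
  [IsAlgClosed K] [Algebra.IsAlgebraic (ZMod p) K]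

noncomputable def fpol (c : K) : K[X] := (X ^ p - X) * (X ^ p - X + C c) ^ (p - 2)

theorem fpol_deg (c : K) : (fpol p c).natDegree = p * (p - 1) := by
  have hp := (Fact.out : p.Prime).two_le
  have h1 : (X ^ p - X : K[X]).natDegree = p :=
    FiniteField.X_pow_card_sub_X_natDegree_eq K (Fact.out : p.Prime).one_lt
  have h2 : (X ^ p - X + C c : K[X]).natDegree = p := by rw [natDegree_add_C, h1]
  have h3 : (X ^ p - X + C c : K[X]) ≠ 0 := by
    intro h; rw [h] at h2; simp at h2; omega
  rw [fpol, natDegree_mul (FiniteField.X_pow_card_sub_X_ne_zero K (Fact.out : p.Prime).one_lt)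
    (pow_ne_zero _ h3), natDegree_pow, h1, h2]
  obtain ⟨k, rfl⟩ := Nat.exists_eq_add_of_le' hp
  simp; ring

theorem fpol_coeff (c : K) (hc : c ≠ 0) : (fpol p c).coeff 0 = 0 ∧ (fpol p c).coeff 1 ≠ 0 := by
  have hp := (Fact.out : p.Prime).two_le
  obtain ⟨k, hk⟩ := Nat.exists_eq_add_of_le' hp
  have h : fpol p c = X * ((X ^ (k + 1) - 1) * (X ^ p - X + C c) ^ (p - 2)) := by
    rw [fpol, show X ^ p - X = (X : K[X]) * (X ^ (k + 1) - 1) by rw [hk]; ring]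
    ring
  rw [h]
  constructor
  · simp
  · rw [coeff_X_mul, coeff_zero_eq_eval_zero]
    have : p ≠ 0 := by omega
    simp [this, hc]

variable (c : ZMod p) (r : ℕ)

/-- elements with given norm ratio and trace -/
noncomputable def good [DecidableEq K] : Finset K :=
  (Fix p r).filter (fun x => (Qpol p r x).eval 0 ≠ 0 ∧ (Qpol p r x).eval (-c) ≠ 0)

noncomputable def uv (x : K) : ZMod p × ZMod p :=
  ((Qpol p r x).eval 0 * ((Qpol p r x).eval (-c))⁻¹, -(Qpol p r x).nextCoeff)

theorem fiber_bound [DecidableEq K] (hc : c ≠ 0) (s t : ℕ) (ht : 0 < t) (hs : 0 < s)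
    (hdt : p ^ s = (p - 1) * t + 1) (w : ZMod p × ZMod p) :
    (p - 1) * t * (p * ((good p c (2 * s) : Finset K).filter (fun x => uv p c (2 * s) x = w)).card) ≤
      ((p - 1) * t + (p - 1) * (t * (p ^ s + 1))) * (p * (p - 1)) + t * (p ^ s + 1) +
        p ^ (2 * s) * (t + p * (p - 1)) := by
  have hp := (Fact.out : p.Prime).two_le
  set Y := (good p c (2 * s) : Finset K).filter (fun x => uv p c (2 * s) x = w) with hY
  set S : Finset K := Y.biUnion (fun x => (X ^ p - X - C x : K[X]).roots.toFinset) with hSdef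
  have hcard : S.card = p * Y.card := by
    rw [hSdef, Finset.card_biUnion]
    · rw [Finset.sum_congr rfl (fun x _ => (card_AS p x).1), Finset.sum_const, smul_eq_mul, mul_comm]
    · intro x _ y _ hxy
      rw [Function.onFun, Finset.disjoint_left]
      intro z hz hz'
      exact hxy (((card_AS p x).2 z hz).symm.trans ((card_AS p y).2 z hz'))
  rw [← hcard]
  have hc' : algebraMap (ZMod p) K c ≠ 0 := by simpa using hc
  have hf := fpol_coeff p _ hc'
  apply stepanov p s (p - 1) t (p * (p - 1)) (by omega) ht hdt (fpol p (algebraMap (ZMod p) K c))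
    (fpol_deg p _) hf.1 hf.2 (algebraMap (ZMod p) K w.2) (algebraMap (ZMod p) K w.1)
  intro z hz
  rw [hSdef, Finset.mem_biUnion] at hz
  obtain ⟨x, hx, hz⟩ := hz
  have hzx := (card_AS p x).2 z hz
  rw [hY, Finset.mem_filter, good, Finset.mem_filter, mem_Fix p _ (by omega)] at hx
  obtain ⟨⟨hfix, he0, he1⟩, hw⟩ := hx
  have hsum : ∑ i ∈ Finset.range (2 * s), p ^ i = t * (p ^ s + 1) := by
    have h1 : (p - 1) * ∑ i ∈ Finset.range (2 * s), p ^ i + 1 = p ^ (2 * s) := by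
      have := Nat.geomSum_eq hp (2 * s)
      have h2 := Nat.sub_one_dvd_pow_sub_one p (2 * s)
      have h3 : 0 < p ^ (2 * s) := by positivity
      rw [this, Nat.mul_div_cancel' h2]; omega
    have h2 : p ^ (2 * s) = (p - 1) * (t * (p ^ s + 1)) + 1 := by
      rw [mul_comm 2 s, pow_mul, hdt]; ring
    have h3 : (p - 1) * ∑ i ∈ Finset.range (2 * s), p ^ i = (p - 1) * (t * (p ^ s + 1)) := by omega
    exact Nat.eq_of_mul_eq_mul_left (by omega) h3
  constructor
  · rw [← hw, uv, Qpol_next p _ x hfix, ← hzx]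
    exact trace_tel p _ z
  · have e0 := Qpol_eval p _ x hfix 0
    have e1 := Qpol_eval p _ x hfix (-c)
    rw [hsum] at e0 e1
    have hinv : ((Qpol p (2 * s) x).eval (-c))⁻¹ = ((Qpol p (2 * s) x).eval (-c)) ^ (p - 2) := by
      rw [inv_eq_iff_eq_inv, ← one_div, eq_div_iff (pow_ne_zero _ he1), ← pow_succ',
        show p - 2 + 1 = p - 1 by omega, ZMod.pow_card_sub_one_eq_one he1]
    have hm1 : (-1 : K) ^ (p - 1) = 1 := by
      have : (-1 : ZMod p) ^ (p - 1) = 1 := ZMod.pow_card_sub_one_eq_one (by simp)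
      have := congrArg (algebraMap (ZMod p) K) this
      simpa using this
    rw [← hw, uv]
    simp only [hinv, map_mul, map_pow, e0, e1]
    simp only [fpol, eval_mul, eval_sub, eval_pow, eval_X, eval_add, eval_C, hzx, map_zero, map_neg]
    rw [← pow_mul, mul_comm _ (p - 2), pow_mul (-(algebraMap (ZMod p) K) c - x), ← mul_pow]
    congr 1
    rw [show (0 - x) = (-1) * x by ring, show (-algebraMap (ZMod p) K c - x) = (-1) * (x + algebraMap (ZMod p) K c) by ring,
      mul_pow]
    have : (-1 : K) * (-1) ^ (p - 2) = 1 := by rw [← pow_succ', show p - 2 + 1 = p - 1 by omega, hm1]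
    linear_combination (-(x * (x + algebraMap (ZMod p) K c) ^ (p - 2))) * this

theorem W_bound (χ : MulChar (ZMod p) ℂ) (ψ : AddChar (ZMod p) ℂ) (hψ : ψ ≠ 1) (hc : c ≠ 0) :
    ∃ A : ℝ, ∀ s : ℕ, 1 ≤ s →
      ‖∑ ρ ∈ (Fix p (2 * s) : Finset K), Lam p χ ψ c (Qpol p (2 * s) ρ)‖ ≤ A * (p : ℝ) ^ s := by
  classical
  have hp := (Fact.out : p.Prime).two_le
  refine ⟨3 * (p - 1) * (p * (p - 1)) + 4 + p * (p * (p - 1)), fun s hs => ?_⟩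
  obtain ⟨t, ht⟩ := Nat.sub_one_dvd_pow_sub_one p s
  have hps : 2 ≤ p ^ s := hp.trans (Nat.le_self_pow (by omega) p)
  have hdt : p ^ s = (p - 1) * t + 1 := by omega
  have htpos : 0 < t := by
    rcases Nat.eq_zero_or_pos t with h | h
    · subst h; omega
    · exact h
  set r := 2 * s with hr
  set G : Finset K := good p c r with hG
  set T : Finset (ZMod p × ZMod p) := (Finset.univ.erase 0) ×ˢ Finset.univ with hT
  set φ : ZMod p × ZMod p → ℂ := fun w => χ w.1 * ψ w.2 with hφ
  have h1 : ∑ ρ ∈ (Fix p r : Finset K), Lam p χ ψ c (Qpol p r ρ) = ∑ ρ ∈ G, φ (uv p c r ρ) := by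
    rw [hG, good, Finset.sum_filter]
    refine Finset.sum_congr rfl fun ρ _ => ?_
    split_ifs with h
    · simp only [Lam, hφ, uv, map_mul, MulChar.inv_apply']
    · rw [Lam]
      rw [not_and_or, not_not, not_not] at h
      rcases h with h | h <;> simp [h, MulChar.map_zero]
  have hmaps : ∀ ρ ∈ G, uv p c r ρ ∈ T := by
    intro ρ hρ
    rw [hG, good, Finset.mem_filter] at hρ
    rw [hT, Finset.mem_product, Finset.mem_erase]
    exact ⟨⟨mul_ne_zero hρ.2.1 (inv_ne_zero hρ.2.2), Finset.mem_univ _⟩, Finset.mem_univ _⟩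
  set cnt : ZMod p × ZMod p → ℝ := fun w => ((G.filter (fun x => uv p c r x = w)).card : ℝ) with hcnt
  have h2 : ∑ ρ ∈ G, φ (uv p c r ρ) = ∑ w ∈ T, φ w * cnt w := by
    rw [← Finset.sum_fiberwise_of_maps_to hmaps]
    refine Finset.sum_congr rfl fun w _ => ?_
    rw [Finset.sum_congr rfl (g := fun _ => φ w) (fun x hx => by rw [(Finset.mem_filter.1 hx).2]),
      Finset.sum_const, nsmul_eq_mul, mul_comm, hcnt]
    simp
  have h3 : ∑ w ∈ T, φ w = 0 := by
    rw [hT, Finset.sum_product]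
    simp only [hφ, ← Finset.mul_sum, AddChar.sum_eq_zero_of_ne_one hψ, mul_zero, Finset.sum_const_zero]
  have h4 : (∑ w ∈ T, cnt w) = (G.card : ℝ) := by
    rw [Finset.card_eq_sum_card_fiberwise hmaps]; push_cast; rfl
  have h5 : (p : ℝ) ^ r ≤ G.card + 2 := by
    have hsub : (Fix p r : Finset K) ⊆ G ∪ {0, -algebraMap (ZMod p) K c} := by
      intro x hx
      by_cases hx1 : x = 0
      · simp [hx1]
      by_cases hx2 : x = -algebraMap (ZMod p) K c
      · simp [hx2]
      refine Finset.mem_union_left _ ?_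
      rw [hG, good, Finset.mem_filter]
      rw [mem_Fix p r (by omega)] at hx
      refine ⟨(mem_Fix p r (by omega) x).2 hx, fun h => ?_, fun h => ?_⟩
      · have := Qpol_eval p r x hx 0
        rw [h, map_zero] at this
        have := eq_zero_of_pow_eq_zero this.symm
        apply hx1; simpa using this
      · have := Qpol_eval p r x hx (-c)
        rw [h, map_zero] at this
        have := eq_zero_of_pow_eq_zero this.symm
        apply hx2; rw [map_neg] at this; exact (sub_eq_zero.1 this).symm
    have := (Finset.card_le_card hsub).trans (Finset.card_union_le _ _)
    rw [card_Fix p r (by omega)] at this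
    have h6 : ({0, -algebraMap (ZMod p) K c} : Finset K).card ≤ 2 := Finset.card_le_two
    exact_mod_cast this.trans (Nat.add_le_add_left h6 _)
  have hTc : (T.card : ℝ) = (p - 1) * p := by
    rw [hT, Finset.card_product, Finset.card_erase_of_mem (Finset.mem_univ _), Finset.card_univ, ZMod.card]
    push_cast [Nat.cast_sub (show 1 ≤ p by omega)]; ring
  set B0 : ℝ := ((p - 1) * t + (p - 1) * (t * (p ^ s + 1))) * (p * (p - 1)) + t * (p ^ s + 1) +
        p ^ r * (t + p * (p - 1)) with hB0
  have hp1 : (0 : ℝ) < p - 1 := by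
    have : (2 : ℝ) ≤ p := by exact_mod_cast hp
    linarith
  have hp0 : (0 : ℝ) < p := by linarith
  have ht0 : (0 : ℝ) < t := by exact_mod_cast htpos
  set B : ℝ := B0 / ((p - 1) * t * p) with hB
  have hcB : ∀ w, cnt w ≤ B := by
    intro w
    rw [hB, le_div_iff₀ (by positivity)]
    have := fiber_bound (K := K) p c hc s t htpos hs hdt w
    have h7 : (((p - 1) * t * (p * (G.filter (fun x => uv p c r x = w)).card) : ℕ) : ℝ) ≤ 
      ((((p - 1) * t + (p - 1) * (t * (p ^ s + 1))) * (p * (p - 1)) + t * (p ^ s + 1) +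
        p ^ (2 * s) * (t + p * (p - 1)) : ℕ) : ℝ) := by exact_mod_cast this
    push_cast [Nat.cast_sub (show 1 ≤ p by omega)] at h7
    rw [hB0, hcnt]
    refine le_trans (le_of_eq ?_) h7
    ring
  have h6 : ∑ w ∈ T, φ w * cnt w = ∑ w ∈ T, φ w * ((cnt w - B : ℝ) : ℂ) := by
    have : ∑ w ∈ T, φ w * ((cnt w - B : ℝ) : ℂ) = ∑ w ∈ T, φ w * cnt w - (∑ w ∈ T, φ w) * B := by
      rw [Finset.sum_mul, ← Finset.sum_sub_distrib]
      refine Finset.sum_congr rfl fun w _ => ?_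
      push_cast; ring
    rw [this, h3]; simp
  have hφ1 : ∀ w, ‖φ w‖ ≤ 1 := by
    intro w
    rw [hφ, norm_mul, AddChar.norm_apply, mul_one]
    by_cases h : IsUnit w.1
    · exact DirichletCharacter.norm_le_one χ w.1
    · rw [MulChar.map_nonunit _ h]; simp
  rw [h1, h2, h6]
  have h8 : ‖∑ w ∈ T, φ w * ((cnt w - B : ℝ) : ℂ)‖ ≤ ∑ w ∈ T, (B - cnt w) := by
    refine (norm_sum_le _ _).trans (Finset.sum_le_sum fun w _ => ?_)
    rw [norm_mul, Complex.norm_real, Real.norm_eq_abs, abs_of_nonpos (by linarith [hcB w])]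
    have := hφ1 w
    have := hcB w
    nlinarith
  refine h8.trans ?_
  rw [Finset.sum_sub_distrib, h4, Finset.sum_const, nsmul_eq_mul, hTc]
  have h9 : ((p : ℝ) - 1) * p * B = B0 / t := by
    rw [hB]; field_simp
  rw [h9]
  have hQ : (p : ℝ) ^ s = (p - 1) * t + 1 := by
    have : ((p ^ s : ℕ) : ℝ) = (((p - 1) * t + 1 : ℕ) : ℝ) := by exact_mod_cast hdt
    push_cast [Nat.cast_sub (show 1 ≤ p by omega)] at this
    exact this
  have hq : (p : ℝ) ^ r = p ^ s * p ^ s := by rw [hr, two_mul, pow_add]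
  have hQ1 : (1 : ℝ) ≤ (p : ℝ) ^ s := by exact_mod_cast (by omega : 1 ≤ p ^ s)
  have ht1 : (1 : ℝ) ≤ t := by exact_mod_cast htpos
  have h10 : B0 / t = ((p - 1) + (p - 1) * (p ^ s + 1)) * (p * (p - 1)) + (p ^ s + 1) +
        p ^ r + p ^ s * (p ^ s / t) * (p * (p - 1)) := by
    rw [hB0, hq]; field_simp; ring
  have h11 : (p : ℝ) ^ s / t ≤ p := by
    rw [div_le_iff₀ ht0, hQ]; nlinarith
  rw [h10]
  set Q := (p : ℝ) ^ s
  set m := (p : ℝ) * (p - 1) with hm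
  have hm0 : 0 ≤ m := by positivity
  have h12 : Q * (Q / t) * m ≤ Q * p * m := by gcongr
  have h13 : ((p - 1) + (p - 1) * (Q + 1)) * m ≤ 3 * (p - 1) * m * Q := by
    have : 0 ≤ ((p : ℝ) - 1) * m := by positivity
    nlinarith
  nlinarith

end

theorem prime_main (p : ℕ) [Fact p.Prime] (χ : MulChar (ZMod p) ℂ) (ψ : AddChar (ZMod p) ℂ) (hψ : ψ ≠ 1)
    (c : ZMod p) (hc : c ≠ 0) :
    ‖∑ a : ZMod p, χ a * χ⁻¹ (a + c) * ψ a‖ ≤ 2 * Real.sqrt p := by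
  let K := AlgebraicClosure (ZMod p)
  have : CharP K p := charP_of_injective_algebraMap (algebraMap (ZMod p) K).injective p
  obtain ⟨α, β, h1, h2⟩ := power_sums (Ssum p (Lam p χ ψ c))
    (fun r => ∑ ρ ∈ (Fix p r : Finset K), Lam p χ ψ c (Qpol p r ρ)) (S_zero p χ ψ c)
    (S_ge p χ ψ c hψ) (newton p (Lam p χ ψ c) (Lam_mul p χ ψ c))
  obtain ⟨A, hA⟩ := W_bound (K := K) p c χ ψ hψ hc
  have hp0 : (0 : ℝ) < p := by exact_mod_cast (Fact.out : p.Prime).pos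
  have h3 : ∀ s : ℕ, 1 ≤ s → ‖(α ^ 2) ^ s + (β ^ 2) ^ s‖ ≤ A * (p : ℝ) ^ s := by
    intro s hs
    have := hA s hs
    rw [h2 (2 * s) (by omega), norm_neg, pow_mul, pow_mul] at this
    exact this
  have key : ∀ a : ℂ, ‖a ^ 2‖ ≤ p → ‖a‖ ≤ Real.sqrt p := by
    intro a ha
    rw [norm_pow] at ha
    exact Real.le_sqrt_of_sq_le ha
  have ha := key α (eig_bound _ _ p A hp0 h3)
  have hb := key β (eig_bound (β ^ 2) (α ^ 2) p A hp0 (fun s hs => by rw [add_comm]; exact h3 s hs))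
  rw [← S_one, h1, norm_neg]
  exact (norm_add_le _ _).trans (by linarith)

end WeilAux

namespace WeilAux

noncomputable def Wg {R : Type*} [CommRing R] [Fintype R] (χ : MulChar R ℂ) (ψ : AddChar R ℂ)
    (h : R) : ℂ :=
  ∑ n : R, χ n * (starRingEnd ℂ) (χ (n + h)) * ψ n

theorem Wg_prime (p : ℕ) [Fact p.Prime] (χ : MulChar (ZMod p) ℂ) (hχ : χ ≠ 1)
    (ψ : AddChar (ZMod p) ℂ) (h : ZMod p) [Decidable (h = 0 ∧ ψ = 1)] :
    ‖Wg χ ψ h‖ ≤ 2 * Real.sqrt p * (if h = 0 ∧ ψ = 1 then Real.sqrt p else 1) := by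
  have hp1 : (1 : ℝ) ≤ Real.sqrt p := by
    rw [Real.one_le_sqrt]; exact_mod_cast (Fact.out : p.Prime).one_lt.le
  have hstar : ∀ a, (starRingEnd ℂ) (χ a) = χ⁻¹ a := fun a => MulChar.star_apply' χ a
  have hW : Wg χ ψ h = ∑ a : ZMod p, χ a * χ⁻¹ (a + h) * ψ a := by
    simp only [Wg, hstar]
  split_ifs with hc
  · rw [Wg]
    refine (norm_sum_le _ _).trans ?_
    have h1 : ∀ n ∈ (Finset.univ : Finset (ZMod p)),
        ‖χ n * (starRingEnd ℂ) (χ (n + h)) * ψ n‖ ≤ 1 := by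
      intro n _
      rw [norm_mul, norm_mul, AddChar.norm_apply, mul_one, RCLike.norm_conj]
      exact mul_le_one₀ (DirichletCharacter.norm_le_one χ _) (norm_nonneg _)
        (DirichletCharacter.norm_le_one χ _)
    refine (Finset.sum_le_sum h1).trans ?_
    rw [Finset.sum_const, Finset.card_univ, ZMod.card, nsmul_eq_mul, mul_one, mul_assoc,
      Real.mul_self_sqrt (by positivity)]
    have : (0 : ℝ) ≤ p := by positivity
    linarith
  · rw [mul_one]
    by_cases h0 : h = 0
    · have hψ : ψ ≠ 1 := fun h1 => hc ⟨h0, h1⟩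
      have h2 : Wg χ ψ h = -1 := by
        rw [hW, h0]
        have h3 : ∀ a ∈ (Finset.univ : Finset (ZMod p)),
            χ a * χ⁻¹ (a + 0) * ψ a = ψ a - (if a = 0 then 1 else 0) := by
          intro a _
          rw [add_zero, ← MulChar.mul_apply, mul_inv_cancel]
          split_ifs with ha
          · rw [ha, MulChar.map_zero]; simp
          · rw [MulChar.one_apply (isUnit_iff_ne_zero.2 ha)]; simp
        rw [Finset.sum_congr rfl h3, Finset.sum_sub_distrib, AddChar.sum_eq_zero_of_ne_one hψ]
        simp
      rw [h2, norm_neg, norm_one]; linarith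
    · by_cases hψ : ψ = 1
      · have h2 : Wg χ ψ h = χ (-1) * jacobiSum χ χ⁻¹ := by
          rw [hW, hψ, jacobiSum, Finset.mul_sum]
          symm
          refine Fintype.sum_equiv (Equiv.mulLeft₀ (-h) (neg_ne_zero.2 h0)) _ _ fun x => ?_
          have h4 : χ h * χ⁻¹ h = 1 := by
            rw [← MulChar.mul_apply, mul_inv_cancel, MulChar.one_apply (isUnit_iff_ne_zero.2 h0)]
          have h5 : Equiv.mulLeft₀ (-h) (neg_ne_zero.2 h0) x = -h * x := rfl
          simp only [h5, AddChar.one_apply, mul_one]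
          rw [show -h * x + h = h * (1 - x) by ring, show -h * x = (-1) * (h * x) by ring,
            map_mul, map_mul, map_mul]
          linear_combination (-(χ (-1) * χ x * χ⁻¹ (1 - x))) * h4
        rw [h2, jacobiSum_nontrivial_inv hχ, mul_neg, norm_neg, ← map_mul]
        simp
        linarith
      · rw [hW]; exact prime_main p χ ψ hψ h h0

section crt
variable {R R₁ R₂ : Type*} [CommRing R] [CommRing R₁] [CommRing R₂]

noncomputable def chFst (e : R ≃+* R₁ × R₂) (χ : MulChar R ℂ) : MulChar R₁ ℂ where
  toFun a := χ (e.symm (a, 1))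
  map_one' := by
    rw [show ((1 : R₁), (1 : R₂)) = 1 from rfl, map_one, map_one]
  map_mul' a b := by
    rw [← map_mul, ← map_mul]; simp
  map_nonunit' a ha := by
    apply MulChar.map_nonunit
    intro hu
    have := hu.map e
    rw [RingEquiv.apply_symm_apply, Prod.isUnit_iff] at this
    exact ha this.1

noncomputable def chSnd (e : R ≃+* R₁ × R₂) (χ : MulChar R ℂ) : MulChar R₂ ℂ where
  toFun a := χ (e.symm (1, a))
  map_one' := by
    rw [show ((1 : R₁), (1 : R₂)) = 1 from rfl, map_one, map_one]
  map_mul' a b := by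
    rw [← map_mul, ← map_mul]; simp
  map_nonunit' a ha := by
    apply MulChar.map_nonunit
    intro hu
    have := hu.map e
    rw [RingEquiv.apply_symm_apply, Prod.isUnit_iff] at this
    exact ha this.2

noncomputable def adFst (e : R ≃+* R₁ × R₂) (ψ : AddChar R ℂ) : AddChar R₁ ℂ where
  toFun a := ψ (e.symm (a, 0))
  map_zero_eq_one' := by
    rw [show ((0 : R₁), (0 : R₂)) = 0 from rfl, map_zero, AddChar.map_zero_eq_one]
  map_add_eq_mul' a b := by
    rw [← AddChar.map_add_eq_mul, ← map_add]; simp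

noncomputable def adSnd (e : R ≃+* R₁ × R₂) (ψ : AddChar R ℂ) : AddChar R₂ ℂ where
  toFun a := ψ (e.symm (0, a))
  map_zero_eq_one' := by
    rw [show ((0 : R₁), (0 : R₂)) = 0 from rfl, map_zero, AddChar.map_zero_eq_one]
  map_add_eq_mul' a b := by
    rw [← AddChar.map_add_eq_mul, ← map_add]; simp

theorem ch_split (e : R ≃+* R₁ × R₂) (χ : MulChar R ℂ) (x : R) :
    χ x = chFst e χ (e x).1 * chSnd e χ (e x).2 := by
  change _ = χ (e.symm ((e x).1, 1)) * χ (e.symm (1, (e x).2))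
  rw [← map_mul, ← map_mul]
  simp

theorem ad_split (e : R ≃+* R₁ × R₂) (ψ : AddChar R ℂ) (x : R) :
    ψ x = adFst e ψ (e x).1 * adSnd e ψ (e x).2 := by
  change _ = ψ (e.symm ((e x).1, 0)) * ψ (e.symm (0, (e x).2))
  rw [← AddChar.map_add_eq_mul, ← map_add]
  simp

theorem Wg_split [Fintype R] [Fintype R₁] [Fintype R₂] (e : R ≃+* R₁ × R₂) (χ : MulChar R ℂ)
    (ψ : AddChar R ℂ) (h : R) :
    Wg χ ψ h = Wg (chFst e χ) (adFst e ψ) (e h).1 * Wg (chSnd e χ) (adSnd e ψ) (e h).2 := by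
  simp only [Wg]
  rw [Finset.sum_mul_sum, ← Finset.sum_product', Finset.univ_product_univ]
  refine Fintype.sum_equiv e.toEquiv _ _ fun x => ?_
  rw [ch_split e χ x, ch_split e χ (x + h), ad_split e ψ x]
  simp only [map_add, Prod.fst_add, Prod.snd_add, map_mul, RingEquiv.toEquiv_eq_coe,
    EquivLike.coe_coe]
  ring
end crt

open Classical in
theorem Wg_bound (q : ℕ) : ∀ [NeZero q], Squarefree q → ∀ (χ : MulChar (ZMod q) ℂ)
    (ψ : AddChar (ZMod q) ℂ) (h : ℤ),
    (∀ p : ℕ, p.Prime → p ∣ q → ∃ b : ZMod q, χ (1 + ((q / p : ℕ) : ZMod q) * b) ≠ 0 ∧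
      χ (1 + ((q / p : ℕ) : ZMod q) * b) ≠ 1) →
    ‖Wg χ ψ (h : ZMod q)‖ ≤ ∏ p ∈ q.primeFactors, (2 * Real.sqrt p *
      (if (p : ℤ) ∣ h ∧ ψ ((q / p : ℕ) : ZMod q) = 1 then Real.sqrt p else 1)) := by
  induction q using induction_on_primes with
  | zero => intro hz; exact absurd rfl hz.out
  | one =>
    intro _ _ χ ψ h _
    rw [Nat.primeFactors_one, Finset.prod_empty, Wg]
    refine (norm_sum_le _ _).trans ?_
    rw [Finset.sum_eq_card_nsmul (b := (1 : ℝ))]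
    · simp
    · intro a _
      have h1 : ∀ b : ZMod 1, χ b = 1 := fun b => by rw [Subsingleton.elim b 1, map_one]
      simp [h1]
  | prime_mul p n hp ih =>
    intro hz hsq χ ψ h hprim
    have hn0 : n ≠ 0 := by rintro rfl; exact hz.out (by simp)
    have : NeZero n := ⟨hn0⟩
    have : Fact p.Prime := ⟨hp⟩
    have hcop : p.Coprime n := Nat.coprime_of_squarefree_mul hsq
    have hsqn : Squarefree n := hsq.of_mul_right
    let e := ZMod.chineseRemainder hcop
    have hpn : ¬ p ∣ n := (Nat.Prime.coprime_iff_not_dvd hp).1 hcop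
    have hdiv : p * n / p = n := Nat.mul_div_cancel_left n hp.pos
    rw [Nat.primeFactors_mul hp.ne_zero hn0, hp.primeFactors, Finset.singleton_union,
      Finset.prod_insert (by simp [hpn]), Wg_split e, norm_mul]
    have hh : e (h : ZMod (p * n)) = ((h : ZMod p), (h : ZMod n)) := by rw [map_intCast]; rfl
    rw [hh]
    have hχ1 : chFst e χ ≠ 1 := by
      intro h1
      obtain ⟨b, hb0, hb1⟩ := hprim p hp (dvd_mul_right _ _)
      rw [hdiv] at hb0 hb1
      have h2 := ch_split e χ (1 + (n : ZMod (p * n)) * b)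
      have h3 : (e (1 + (n : ZMod (p * n)) * b)).2 = 1 := by
        rw [map_add, map_mul, map_one, map_natCast]; simp
      rw [h3, map_one, mul_one, h1] at h2
      by_cases hu : IsUnit (e (1 + (n : ZMod (p * n)) * b)).1
      · rw [MulChar.one_apply hu] at h2; exact hb1 h2
      · rw [MulChar.map_nonunit _ hu] at h2; exact hb0 h2
    have hB1 := Wg_prime p (chFst e χ) hχ1 (adFst e ψ) (h : ZMod p)
    have hB2 := ih hsqn (chSnd e χ) (adSnd e ψ) h (by
      intro p' hp' hd
      obtain ⟨b, hb⟩ := hprim p' hp' (hd.mul_left p)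
      refine ⟨p * (e b).2, ?_⟩
      have h2 := ch_split e χ (1 + ((p : ZMod (p * n)) * ((n / p' : ℕ) : ZMod (p * n))) * b)
      have h3 : (e (1 + ((p : ZMod (p * n)) * ((n / p' : ℕ) : ZMod (p * n))) * b)).1 = 1 := by
        rw [map_add, map_mul, map_mul, map_one, map_natCast, map_natCast]; simp
      have h4 : (e (1 + ((p : ZMod (p * n)) * ((n / p' : ℕ) : ZMod (p * n))) * b)).2 =
          1 + ((p : ZMod n) * ((n / p' : ℕ) : ZMod n)) * (e b).2 := by
        rw [map_add, map_mul, map_mul, map_one, map_natCast, map_natCast]; rfl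
      rw [h3, h4, map_one, one_mul] at h2
      rw [Nat.mul_div_assoc _ hd] at hb
      rw [Nat.cast_mul, h2] at hb
      rwa [show ((n / p' : ℕ) : ZMod n) * (p * (e b).2) = p * ((n / p' : ℕ) : ZMod n) * (e b).2 by ring])
    refine mul_le_mul (hB1.trans ?_) (hB2.trans ?_) (norm_nonneg _) (by positivity)
    · refine mul_le_mul_of_nonneg_left ?_ (by positivity)
      have hp1 : (1 : ℝ) ≤ Real.sqrt p := by
        rw [Real.one_le_sqrt]; exact_mod_cast hp.one_lt.le
      have himp : ((h : ZMod p) = 0 ∧ adFst e ψ = 1) →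
          ((p : ℤ) ∣ h ∧ ψ ((p * n / p : ℕ) : ZMod (p * n)) = 1) := by
        rintro ⟨h1, h2⟩
        refine ⟨(ZMod.intCast_zmod_eq_zero_iff_dvd h p).1 h1, ?_⟩
        rw [hdiv, ad_split e ψ, h2, map_natCast]
        simp
      split_ifs with c1 c2 c2
      · exact le_rfl
      · exact absurd (himp c1) c2
      · exact hp1
      · exact le_rfl
    · refine Finset.prod_le_prod (fun _ _ => by positivity) fun p' hp'm => ?_
      have hp' := Nat.prime_of_mem_primeFactors hp'm
      have hd := Nat.dvd_of_mem_primeFactors hp'm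
      refine mul_le_mul_of_nonneg_left ?_ (by positivity)
      have hp1 : (1 : ℝ) ≤ Real.sqrt p' := by
        rw [Real.one_le_sqrt]; exact_mod_cast hp'.one_lt.le
      have himp : ((p' : ℤ) ∣ h ∧ adSnd e ψ ((n / p' : ℕ) : ZMod n) = 1) →
          ((p' : ℤ) ∣ h ∧ ψ ((p * n / p' : ℕ) : ZMod (p * n)) = 1) := by
        rintro ⟨h1, h2⟩
        refine ⟨h1, ?_⟩
        have h3 : (e ((p : ZMod (p * n)) * ((n / p' : ℕ) : ZMod (p * n)))).1 = 0 := by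
          rw [map_mul, map_natCast, map_natCast]; simp
        have h4 : (e ((p : ZMod (p * n)) * ((n / p' : ℕ) : ZMod (p * n)))).2 =
            (p : ZMod n) * ((n / p' : ℕ) : ZMod n) := by
          rw [map_mul, map_natCast, map_natCast]; rfl
        rw [Nat.mul_div_assoc _ hd, Nat.cast_mul, ad_split e ψ, h3, h4, AddChar.map_zero_eq_one,
          one_mul]
        rw [← nsmul_eq_mul, AddChar.map_nsmul_eq_pow, h2, one_pow]
      split_ifs with c1 c2 c2
      · exact le_rfl
      · exact absurd (himp c1) c2
      · exact hp1
      · exact le_rfl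

theorem prim_exists (q : ℕ) [NeZero q] (χ : DirichletCharacter ℂ q) (hχ : χ.IsPrimitive) (p : ℕ)
    (hp : p.Prime) (hpq : p ∣ q) : ∃ b : ZMod q, χ (1 + ((q / p : ℕ) : ZMod q) * b) ≠ 0 ∧
      χ (1 + ((q / p : ℕ) : ZMod q) * b) ≠ 1 := by
  by_contra! hcon
  have hd : q / p ∣ q := Nat.div_dvd_of_dvd hpq
  have hq : 0 < q := Nat.pos_of_ne_zero (NeZero.ne q)
  have hfac : χ.FactorsThrough (q / p) := by
    rw [DirichletCharacter.factorsThrough_iff_ker_unitsMap hd]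
    intro u hu
    rw [MonoidHom.mem_ker] at hu ⊢
    have h1 : ZMod.castHom hd (ZMod (q / p)) (u : ZMod q) = 1 := by
      have := congrArg Units.val hu
      simpa [ZMod.unitsMap_def] using this
    obtain ⟨z, hz⟩ := ZMod.intCast_surjective (u : ZMod q)
    rw [← hz, map_intCast] at h1
    have h2 : ((z - 1 : ℤ) : ZMod (q / p)) = 0 := by push_cast; rw [h1, sub_self]
    obtain ⟨k, hk⟩ := (ZMod.intCast_zmod_eq_zero_iff_dvd _ _).1 h2
    have h3 : (u : ZMod q) = 1 + ((q / p : ℕ) : ZMod q) * (k : ZMod q) := by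
      rw [← hz, show z = 1 + ((q / p : ℕ) : ℤ) * k by linarith]
      rw [Int.cast_add, Int.cast_mul, Int.cast_one, Int.cast_natCast]
    have h4 := hcon (k : ZMod q)
    rw [← h3] at h4
    ext
    rw [MulChar.coe_toUnitHom]
    rw [h4 ((u.isUnit.map χ).ne_zero)]
    simp
  have h5 := DirichletCharacter.conductor_le_conductor_mem_conductorSet (χ := χ) hfac
  have h6 := Nat.sInf_le (s := χ.conductorSet) hfac
  have h7 : χ.conductor = q := hχ
  rw [DirichletCharacter.conductor] at h7
  have := Nat.div_lt_self hq hp.one_lt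
  omega

theorem two_pow_bound (ε : ℝ) (hε : 0 < ε) : ∃ C : ℝ, 0 < C ∧ ∀ q : ℕ, Squarefree q →
    ∏ _p ∈ q.primeFactors, (2 : ℝ) ≤ C * (q : ℝ) ^ ε := by
  obtain ⟨P, hP⟩ : ∃ P : ℕ, ∀ p : ℕ, P ≤ p → (2 : ℝ) ≤ (p : ℝ) ^ ε :=
    Filter.eventually_atTop.1
      (((tendsto_rpow_atTop hε).comp tendsto_natCast_atTop_atTop).eventually_ge_atTop 2)
  refine ⟨2 ^ P, by positivity, fun q hq => ?_⟩
  have h1 : ∏ p ∈ q.primeFactors, ((p : ℕ) : ℝ) ^ ε = (q : ℝ) ^ ε := by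
    rw [Real.finsetProd_rpow _ _ (fun _ _ => by positivity)]
    congr 1
    rw [← Nat.cast_prod, Nat.prod_primeFactors_of_squarefree hq]
  have h2 : ∏ _p ∈ q.primeFactors, (2 : ℝ) ≤
      ∏ p ∈ q.primeFactors, ((if p < P then (2 : ℝ) else 1) * ((p : ℕ) : ℝ) ^ ε) := by
    refine Finset.prod_le_prod (fun _ _ => by positivity) fun p hp => ?_
    have hp1 : (1 : ℝ) ≤ (p : ℝ) ^ ε := Real.one_le_rpow
      (by exact_mod_cast (Nat.prime_of_mem_primeFactors hp).one_lt.le) hε.le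
    split_ifs with h
    · linarith
    · rw [one_mul]; exact hP p (not_lt.1 h)
  refine h2.trans ?_
  rw [Finset.prod_mul_distrib, h1]
  refine mul_le_mul_of_nonneg_right ?_ (by positivity)
  rw [Finset.prod_ite, Finset.prod_const_one, mul_one, Finset.prod_const]
  refine pow_le_pow_right₀ (by norm_num) ?_
  calc _ ≤ (Finset.range P).card := Finset.card_le_card (fun x hx => by
        simpa using (Finset.mem_filter.1 hx).2)
    _ = P := Finset.card_range P

theorem prod_sqrt (s : Finset ℕ) : ∏ p ∈ s, Real.sqrt p = Real.sqrt ((∏ p ∈ s, p : ℕ) : ℝ) := by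
  simp only [Real.sqrt_eq_rpow]
  rw [Real.finsetProd_rpow _ _ (fun _ _ => by positivity)]
  push_cast; rfl

end WeilAux

namespace WeilAux

theorem Wsum_eq (q : ℕ) [NeZero q] (χ : DirichletCharacter ℂ q) (h x : ℤ) :
    Wsum χ h x = Wg χ (AddChar.mulShift ZMod.stdAddChar (x : ZMod q)) (h : ZMod q) := by
  rw [Wsum, Wg]
  refine Finset.sum_bij' (fun n _ => (n : ZMod q)) (fun a _ => a.val) (fun _ _ => Finset.mem_univ _)
    (fun a _ => Finset.mem_range.2 a.val_lt)
    (fun n hn => ZMod.val_cast_of_lt (Finset.mem_range.1 hn)) (fun a _ => ZMod.natCast_zmod_val a) ?_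
  intro n _
  congr 1
  have h1 : (x : ZMod q) * (n : ZMod q) = ((x * n : ℤ) : ZMod q) := by push_cast; rfl
  rw [AddChar.mulShift_apply, h1, ZMod.stdAddChar_coe]
  congr 1
  push_cast; ring

theorem final_bound :
    ∀ ε : ℝ, 0 < ε → ∃ C : ℝ, 0 < C ∧
      ∀ q : ℕ, 0 < q → Squarefree q →
        ∀ χ : DirichletCharacter ℂ q, χ.IsPrimitive → ∀ h x : ℤ,
          ‖Wsum χ h x‖ ≤ C * (q : ℝ) ^ ((1 : ℝ) / 2 + ε) *
            Real.sqrt (Int.gcd h (Int.gcd x q)) := by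
  classical
  intro ε hε
  obtain ⟨C, hC, hCq⟩ := two_pow_bound ε hε
  refine ⟨C, hC, fun q hq hsq χ hχ h x => ?_⟩
  have : NeZero q := ⟨hq.ne'⟩
  have hq0 : (0 : ℝ) < q := by exact_mod_cast hq
  rw [Wsum_eq]
  refine (Wg_bound q hsq χ _ h (fun p hp hpq => prim_exists q χ hχ p hp hpq)).trans ?_
  rw [Finset.prod_mul_distrib, Finset.prod_mul_distrib, prod_sqrt,
    Nat.prod_primeFactors_of_squarefree hsq, Finset.prod_ite, Finset.prod_const_one, mul_one,
    prod_sqrt]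
  have h1 : C * (q : ℝ) ^ ((1 : ℝ) / 2 + ε) = C * (q : ℝ) ^ ε * Real.sqrt q := by
    rw [Real.rpow_add hq0, Real.sqrt_eq_rpow]; ring
  rw [h1]
  have h2 := hCq q hsq
  refine mul_le_mul (mul_le_mul_of_nonneg_right h2 (by positivity)) ?_ (by positivity) (by positivity)
  refine Real.sqrt_le_sqrt ?_
  have hg : 0 < Int.gcd h (Int.gcd x q) := by
    refine Int.gcd_pos_of_ne_zero_right _ ?_
    have : 0 < Int.gcd x q := Int.gcd_pos_of_ne_zero_right _ (by exact_mod_cast hq.ne')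
    exact_mod_cast this.ne'
  refine Nat.cast_le.2 (Nat.le_of_dvd hg ?_)
  refine Finset.prod_primes_dvd _ (fun p hp => ?_) (fun p hp => ?_)
  · exact (Nat.prime_of_mem_primeFactors (Finset.mem_filter.1 hp).1).prime
  · obtain ⟨hpm, hph, hpψ⟩ := Finset.mem_filter.1 hp
    have hpp := Nat.prime_of_mem_primeFactors hpm
    have hpq := Nat.dvd_of_mem_primeFactors hpm
    have hpx : (p : ℤ) ∣ x := by
      rw [AddChar.mulShift_apply, ← (ZMod.stdAddChar (N := q)).map_zero_eq_one,
        ZMod.injective_stdAddChar.eq_iff] at hpψ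
      have h3 : ((x * ((q / p : ℕ) : ℤ) : ℤ) : ZMod q) = 0 := by
        rw [← hpψ, Int.cast_mul, Int.cast_natCast]
      rw [ZMod.intCast_zmod_eq_zero_iff_dvd] at h3
      obtain ⟨m, hm⟩ := hpq
      have hm0 : m ≠ 0 := by rintro rfl; omega
      rw [hm, Nat.mul_div_cancel_left _ hpp.pos] at h3
      push_cast at h3
      exact Int.dvd_of_mul_dvd_mul_right (by exact_mod_cast hm0) h3
    have h4 : (p : ℤ) ∣ (Int.gcd h (Int.gcd x q) : ℤ) := by
      refine Int.dvd_coe_gcd hph (Int.dvd_coe_gcd hpx ?_)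
      exact_mod_cast hpq
    exact_mod_cast h4

end WeilAux

/-- For a primitive character `χ` modulo a squarefree `q`,
`|W_{χ,h}(x)| ≪_ε q^{1/2+ε} gcd(h,x,q)^{1/2}`. -/
theorem Wsum_squarefree_bound :
    ∀ ε : ℝ, 0 < ε → ∃ C : ℝ, 0 < C ∧
      ∀ q : ℕ, 0 < q → Squarefree q →
        ∀ χ : DirichletCharacter ℂ q, χ.IsPrimitive → ∀ h x : ℤ,
          ‖Wsum χ h x‖ ≤ C * (q : ℝ) ^ ((1 : ℝ) / 2 + ε) *
            Real.sqrt (Int.gcd h (Int.gcd x q)) := by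
  exact WeilAux.final_bound
end
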